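/- Let α ∈ ℝ, N ≥ 2, L > 0, and let Q_L ⊂ ℝ² be a square of side length L. Let ψ : (ℝ²)^N → ℂ be smooth, symmetric, normalized (∫|ψ|² = 1), supported in Q_L^N, and with support disjoint from the diagonal set Δ = {x : x_j = x_k for some j ≠ k}. Then the total kinetic energy satisfies (1/2)·∫_{(ℝ²)^N} ∑_{j=1}^N ‖D_j ψ‖² dx ≥ (0.169/2)·c_N·C_{α,N}²·N²/L², where c_N := sup_{γ>0} ( 1/(πγ²) − (1 + 2γ/√N)²/(π²γ⁴) ). -/

import Mathlib

open MeasureTheory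

/-- The anyonic exclusion constant
`C_{α,N} = min_{p ∈ {0,…,N-2}, q ∈ ℤ} |(2p+1)α - 2q|`. -/
noncomputable def Calpha (α : ℝ) (n : ℕ) : ℝ :=
  sInf {c : ℝ | ∃ p : ℕ, ∃ q : ℤ, p ≤ n - 2 ∧ c = |(2 * (p : ℝ) + 1) * α - 2 * (q : ℝ)|}

/-- The `i`-th component of the Aharonov–Bohm magnetic potential
`A_j(x) = α ∑_{k ≠ j} (x_j - x_k)^⊥/|x_j - x_k|²` felt by the `j`-th anyon. -/
noncomputable def anyonA (α : ℝ) {n : ℕ} (x : Fin n → EuclideanSpace ℝ (Fin 2))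
    (j : Fin n) (i : Fin 2) : ℝ :=
  α * ∑ k ∈ Finset.univ.filter (fun k => k ≠ j),
    (if i = 0 then -(x j 1 - x k 1) else x j 0 - x k 0) / ‖x j - x k‖ ^ 2

/-- The `i`-th component of the anyonic magnetic derivative
`D_jψ = -i∇_{x_j}ψ + A_j ψ`. -/
noncomputable def anyonD (α : ℝ) {n : ℕ} (ψ : (Fin n → EuclideanSpace ℝ (Fin 2)) → ℂ)
    (x : Fin n → EuclideanSpace ℝ (Fin 2)) (j : Fin n) (i : Fin 2) : ℂ :=
  (-Complex.I) * fderiv ℝ ψ x (Pi.single j (EuclideanSpace.single i (1 : ℝ)))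
    + (anyonA α x j i : ℂ) * ψ x

section

variable {N : ℕ}

lemma memLp_two_Ioc_of_continuous {f : ℝ → ℂ} (hf : Continuous f) (a b : ℝ) :
    MemLp f 2 (volume.restrict (Set.Ioc a b)) := by
  obtain ⟨M, hM⟩ := (isCompact_Icc (a := a) (b := b)).exists_bound_of_continuousOn hf.continuousOn
  refine MemLp.of_bound hf.aestronglyMeasurable M ?_
  filter_upwards [ae_restrict_mem measurableSet_Ioc] with x hx
  exact hM x ⟨hx.1.le, hx.2⟩

/-- The Fourier coefficients of the derivative of a periodic function. -/
lemma fourierCoeffOn_deriv_of_periodic {a b : ℝ} (hab : a < b) {g g' : ℝ → ℂ}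
    (hg : ∀ x, HasDerivAt g (g' x) x) (hg' : Continuous g') (hper : g b = g a) (n : ℤ) :
    ((b : ℂ) - a) * fourierCoeffOn hab g' n
      = 2 * Real.pi * Complex.I * n * fourierCoeffOn hab g n := by
  rcases eq_or_ne n 0 with rfl | hn
  · have h0 : ∫ x in a..b, g' x = 0 := by
      rw [intervalIntegral.integral_eq_sub_of_hasDerivAt (fun x _ => hg x)
        (hg'.intervalIntegrable _ _), hper, sub_self]
    simp [fourierCoeffOn_eq_integral, h0]
  · rw [fourierCoeffOn_of_hasDerivAt hab hn (fun x _ => hg x) (hg'.intervalIntegrable _ _), hper]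
    have : (n : ℂ) ≠ 0 := by exact_mod_cast hn
    have hpi : (Real.pi : ℂ) ≠ 0 := by exact_mod_cast Real.pi_ne_zero
    field_simp [Complex.I_ne_zero]
    ring

/-- A twisted Wirtinger inequality on an interval of length `π`: the operator
`-i d/dx + β` with periodic boundary conditions has spectrum `β + 2ℤ`. -/
lemma wirtinger_twisted {g g' : ℝ → ℂ} (hg : ∀ x, HasDerivAt g (g' x) x) (hg' : Continuous g')
    (hper : g Real.pi = g 0) {β C : ℝ} (hC : ∀ q : ℤ, C ^ 2 ≤ (β - 2 * q) ^ 2) :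
    C ^ 2 * ∫ x in (0 : ℝ)..Real.pi, ‖g x‖ ^ 2
      ≤ ∫ x in (0 : ℝ)..Real.pi, ‖g' x + Complex.I * β * g x‖ ^ 2 := by
  have hpi : (0 : ℝ) < Real.pi := Real.pi_pos
  have hgc : Continuous g := continuous_iff_continuousAt.2 fun x => (hg x).continuousAt
  have hhc : Continuous fun x => g' x + Complex.I * β * g x := by fun_prop
  have hcoef : ∀ n : ℤ, fourierCoeffOn hpi (fun x => g' x + Complex.I * β * g x) n
      = Complex.I * ((β - 2 * ((-n : ℤ) : ℝ) : ℝ) : ℂ) * fourierCoeffOn hpi g n := by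
    intro n
    have h1 := fourierCoeffOn_deriv_of_periodic hpi hg hg' hper n
    have h2 : fourierCoeffOn hpi (fun x => g' x + Complex.I * β * g x) n
        = fourierCoeffOn hpi g' n + Complex.I * β * fourierCoeffOn hpi g n := by
      have hF : Continuous fun x : ℝ => fourier (-n) (x : AddCircle (Real.pi - 0)) :=
        (map_continuous (fourier (-n))).comp (AddCircle.continuous_mk' _)
      rw [← fourierCoeffOn.const_mul]
      simp only [fourierCoeffOn_eq_integral, smul_eq_mul, mul_add]
      rw [intervalIntegral.integral_add (Continuous.intervalIntegrable (by fun_prop) _ _)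
        (Continuous.intervalIntegrable (by fun_prop) _ _), smul_add]
    have hpi' : (Real.pi : ℂ) ≠ 0 := by exact_mod_cast Real.pi_ne_zero
    have h3 : fourierCoeffOn hpi g' n = 2 * Complex.I * n * fourierCoeffOn hpi g n := by
      apply mul_left_cancel₀ hpi'
      rw [Complex.ofReal_zero, sub_zero] at h1
      rw [h1]; ring
    rw [h2, h3]
    push_cast
    ring
  have s1 := hasSum_sq_fourierCoeffOn hpi (memLp_two_Ioc_of_continuous hgc 0 Real.pi)
  have s2 := hasSum_sq_fourierCoeffOn hpi (memLp_two_Ioc_of_continuous hhc 0 Real.pi)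
  have key := hasSum_le (fun n => ?_) (s1.mul_left (C ^ 2)) s2
  · rw [smul_eq_mul, smul_eq_mul, sub_zero, mul_left_comm] at key
    exact le_of_mul_le_mul_left key (inv_pos.2 hpi)
  · rw [hcoef n, norm_mul, norm_mul, Complex.norm_I, one_mul, mul_pow, Complex.norm_real,
      Real.norm_eq_abs, sq_abs]
    exact mul_le_mul_of_nonneg_right (hC (-n)) (by positivity)

/-- One-dimensional magnetic Poincaré inequality on a circle of length `π` carrying the total
flux `πβ`. -/
lemma magnetic_circle_poincare {u u' : ℝ → ℂ} {a : ℝ → ℝ} (hu : ∀ x, HasDerivAt u (u' x) x)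
    (hu' : Continuous u') (ha : Continuous a) (hper : u Real.pi = u 0) {β C : ℝ}
    (hβ : ∫ x in (0 : ℝ)..Real.pi, a x = Real.pi * β)
    (hC : ∀ q : ℤ, C ^ 2 ≤ (β - 2 * q) ^ 2) :
    C ^ 2 * ∫ x in (0 : ℝ)..Real.pi, ‖u x‖ ^ 2
      ≤ ∫ x in (0 : ℝ)..Real.pi, ‖-Complex.I * u' x + a x * u x‖ ^ 2 := by
  set p : ℝ → ℝ := fun x => (∫ t in (0 : ℝ)..x, a t) - β * x with hp
  have hpd : ∀ x, HasDerivAt p (a x - β) x := fun x =>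
    (intervalIntegral.integral_hasDerivAt_right (ha.intervalIntegrable _ _)
      ha.stronglyMeasurable.stronglyMeasurableAtFilter ha.continuousAt).sub
      (by simpa using (hasDerivAt_id x).const_mul β)
  have hpc : Continuous p := continuous_iff_continuousAt.2 fun x => (hpd x).continuousAt
  have huc : Continuous u := continuous_iff_continuousAt.2 fun x => (hu x).continuousAt
  set e : ℝ → ℂ := fun x => Complex.exp (p x * Complex.I) with he
  have hed : ∀ x, HasDerivAt e (e x * (((a x - β : ℝ) : ℂ) * Complex.I)) x := fun x =>
    (((hpd x).ofReal_comp).mul_const Complex.I).cexp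
  have hen : ∀ x, ‖e x‖ = 1 := fun x => Complex.norm_exp_ofReal_mul_I _
  have key := wirtinger_twisted (g := fun x => e x * u x)
    (g' := fun x => e x * (((a x - β : ℝ) : ℂ) * Complex.I) * u x + e x * u' x)
    (fun x => (hed x).mul (hu x)) (by fun_prop)
    (by simp [he, hp, hβ, hper, mul_comm]) hC
  have n1 : ∀ x, ‖e x * u x‖ = ‖u x‖ := fun x => by rw [norm_mul, hen, one_mul]
  have n2 : ∀ x, ‖e x * (((a x - β : ℝ) : ℂ) * Complex.I) * u x + e x * u' x
      + Complex.I * β * (e x * u x)‖ = ‖-Complex.I * u' x + a x * u x‖ := fun x => by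
    have : e x * (((a x - β : ℝ) : ℂ) * Complex.I) * u x + e x * u' x
      + Complex.I * β * (e x * u x) = e x * (Complex.I * (-Complex.I * u' x + a x * u x)) := by
      push_cast
      linear_combination (e x * u' x) * Complex.I_mul_I
    rw [this, norm_mul, norm_mul, hen, Complex.norm_I, one_mul, one_mul]
  simpa only [n1, n2] using key

/-- The winding number of the unit circle around a point off the circle is `0` or `1`. -/
lemma integral_unit_circle_winding {ζ : ℂ} (hζ : ‖ζ‖ ≠ 1) :
    ∃ m : ℕ, m ≤ 1 ∧ ∫ φ in (0 : ℝ)..2 * Real.pi,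
      (Complex.exp (φ * Complex.I) / (Complex.exp (φ * Complex.I) + ζ)).re
        = 2 * Real.pi * m := by
  have hne : ∀ z : ℂ, ‖z‖ = 1 → z + ζ ≠ 0 := fun z hz h => hζ <| by
    rw [← hz, eq_neg_of_add_eq_zero_left h, norm_neg]
  have hcont : Continuous fun φ : ℝ =>
      Complex.exp (φ * Complex.I) / (Complex.exp (φ * Complex.I) + ζ) :=
    Continuous.div (by fun_prop) (by fun_prop)
      fun φ => hne _ (Complex.norm_exp_ofReal_mul_I φ)
  have hre : ∫ φ in (0 : ℝ)..2 * Real.pi,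
      (Complex.exp (φ * Complex.I) / (Complex.exp (φ * Complex.I) + ζ)).re
      = (∫ φ in (0 : ℝ)..2 * Real.pi,
        Complex.exp (φ * Complex.I) / (Complex.exp (φ * Complex.I) + ζ)).re := by
    have := Complex.reCLM.intervalIntegral_comp_comm
      (hcont.intervalIntegrable (μ := volume) 0 (2 * Real.pi))
    simpa using this
  have hcirc : circleIntegral (fun z => (z - (-ζ))⁻¹) 0 1
      = Complex.I * ∫ φ in (0 : ℝ)..2 * Real.pi,
        Complex.exp (φ * Complex.I) / (Complex.exp (φ * Complex.I) + ζ) := by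
    rw [circleIntegral, ← intervalIntegral.integral_const_mul]
    refine intervalIntegral.integral_congr fun φ _ => ?_
    simp [circleMap, div_eq_mul_inv]
    ring
  rcases lt_or_gt_of_ne hζ with h | h
  · refine ⟨1, le_rfl, ?_⟩
    rw [circleIntegral.integral_sub_inv_of_mem_ball (by simpa using h)] at hcirc
    have : ∫ φ in (0 : ℝ)..2 * Real.pi,
        Complex.exp (φ * Complex.I) / (Complex.exp (φ * Complex.I) + ζ) = 2 * Real.pi :=
      mul_left_cancel₀ Complex.I_ne_zero (by rw [← hcirc]; ring)
    rw [hre, this]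
    simp
  · refine ⟨0, zero_le_one, ?_⟩
    have hz : circleIntegral (fun z => (z - (-ζ))⁻¹) 0 1 = 0 := by
      have hne' : ∀ z ∈ Metric.closedBall (0 : ℂ) 1, z - (-ζ) ≠ 0 := fun z hz h0 => by
        rw [sub_neg_eq_add] at h0
        rw [mem_closedBall_zero_iff, eq_neg_of_add_eq_zero_left h0, norm_neg] at hz
        linarith
      refine Complex.circleIntegral_eq_zero_of_differentiable_on_off_countable zero_le_one
        Set.countable_empty ?_ ?_
      · exact ContinuousOn.inv₀ (by fun_prop) hne'
      · intro z hz
        exact (differentiableAt_id.sub_const _).inv (hne' z (Metric.ball_subset_closedBall hz.1))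
    rw [hz] at hcirc
    have := (mul_eq_zero.1 hcirc.symm).resolve_left Complex.I_ne_zero
    rw [hre, this]
    simp

/-- Diamagnetic fundamental theorem of calculus: the modulus of `u` grows at most with the
modulus of its covariant derivative `-iu' + bu`, for any real `b`. -/
lemma norm_le_add_integral_norm_covariant {u u' : ℝ → ℂ} {b : ℝ → ℝ} {s t : ℝ} (hst : s ≤ t)
    (hu : ∀ x, HasDerivAt u (u' x) x)
    (hw : Continuous fun x => -Complex.I * u' x + b x * u x) :
    ‖u t‖ ≤ ‖u s‖ + ∫ x in s..t, ‖-Complex.I * u' x + b x * u x‖ := by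
  have hder : ∀ x, HasDerivAt (fun x => ‖u x‖ ^ 2) (2 * inner ℝ (u x) (u' x)) x :=
    fun x => (hu x).norm_sq
  have hin : ∀ x, inner ℝ (u x) (u' x) ≤ ‖u x‖ * ‖-Complex.I * u' x + b x * u x‖ := fun x => by
    have : inner ℝ (u x) (u' x)
        = inner ℝ (u x) (Complex.I * (-Complex.I * u' x + b x * u x)) := by
      simp [Complex.inner]
      ring
    rw [this]
    refine (real_inner_le_norm _ _).trans_eq ?_
    rw [norm_mul, Complex.norm_I, one_mul]
  have huc : Continuous u := continuous_iff_continuousAt.2 fun x => (hu x).continuousAt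
  have reg : ∀ ε : ℝ, 0 < ε → √(‖u t‖ ^ 2 + ε) ≤ √(‖u s‖ ^ 2 + ε)
      + ∫ x in s..t, ‖-Complex.I * u' x + b x * u x‖ := by
    intro ε hε
    have hpos : ∀ x, 0 < ‖u x‖ ^ 2 + ε := fun x => by positivity
    have := intervalIntegral.sub_le_integral_of_hasDeriv_right_of_le
      (g := fun x => √(‖u x‖ ^ 2 + ε))
      (g' := fun x => 2 * inner ℝ (u x) (u' x) / (2 * √(‖u x‖ ^ 2 + ε)))
      (φ := fun x => ‖-Complex.I * u' x + b x * u x‖) hst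
      (by fun_prop)
      (fun x _ => (((hder x).add_const ε).sqrt (hpos x).ne').hasDerivWithinAt)
      hw.norm.continuousOn.integrableOn_Icc
      (fun x _ => by
        have h1 : ‖u x‖ ≤ √(‖u x‖ ^ 2 + ε) := Real.le_sqrt_of_sq_le (by linarith)
        have h2 : 0 < √(‖u x‖ ^ 2 + ε) := Real.sqrt_pos.2 (hpos x)
        rw [mul_div_mul_left _ _ two_ne_zero, div_le_iff₀ h2]
        calc _ ≤ _ := hin x
          _ ≤ _ := by
            rw [mul_comm]
            exact mul_le_mul_of_nonneg_left h1 (norm_nonneg _))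
    linarith
  have lim : ∀ x, Filter.Tendsto (fun ε : ℝ => √(‖u x‖ ^ 2 + ε)) (nhdsWithin 0 (Set.Ioi 0))
      (nhds ‖u x‖) := fun x => by
    have : Continuous fun ε : ℝ => √(‖u x‖ ^ 2 + ε) := by fun_prop
    have h := this.tendsto 0
    rw [add_zero, Real.sqrt_sq (norm_nonneg _)] at h
    exact h.mono_left nhdsWithin_le_nhds
  refine le_of_tendsto_of_tendsto (lim t) ((lim s).add_const _) ?_
  filter_upwards [self_mem_nhdsWithin] with ε hε
  exact reg ε hε

lemma sq_integral_le_mul_integral_sq {h : ℝ → ℝ} (hh : Continuous h) {s t : ℝ} (hst : s < t) :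
    (∫ x in s..t, h x) ^ 2 ≤ (t - s) * ∫ x in s..t, h x ^ 2 := by
  set I := ∫ x in s..t, h x with hI
  have hl : 0 < t - s := sub_pos.2 hst
  have h0 : 0 ≤ ∫ x in s..t, (h x - I / (t - s)) ^ 2 :=
    intervalIntegral.integral_nonneg hst.le fun x _ => sq_nonneg _
  have h1 : ∫ x in s..t, (h x - I / (t - s)) ^ 2
      = (∫ x in s..t, h x ^ 2) - I ^ 2 / (t - s) := by
    have : ∀ x, (h x - I / (t - s)) ^ 2
        = h x ^ 2 - 2 * (I / (t - s)) * h x + (I / (t - s)) ^ 2 := fun x => by ring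
    simp only [this]
    rw [intervalIntegral.integral_add, intervalIntegral.integral_sub,
      intervalIntegral.integral_const_mul, intervalIntegral.integral_const, ← hI, smul_eq_mul]
    · field_simp
      ring
    all_goals exact Continuous.intervalIntegrable (by fun_prop) _ _
  rw [h1, sub_nonneg, div_le_iff₀ hl] at h0
  linarith

/-- Growth of `|u|²` between `s` and `t` in terms of the covariant energy, with a fixed choice of
weights `4/3` and `4`. -/
lemma norm_sq_le_add_integral_norm_sq_covariant {u u' : ℝ → ℂ} {b : ℝ → ℝ} {s t : ℝ} (hst : s < t)
    (hu : ∀ x, HasDerivAt u (u' x) x)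
    (hw : Continuous fun x => -Complex.I * u' x + b x * u x) :
    ‖u t‖ ^ 2 ≤ 4 / 3 * ‖u s‖ ^ 2
      + 4 * (t - s) * ∫ x in s..t, ‖-Complex.I * u' x + b x * u x‖ ^ 2 := by
  have h1 := norm_le_add_integral_norm_covariant hst.le hu hw
  have h2 := sq_integral_le_mul_integral_sq hw.norm hst
  have h3 := pow_le_pow_left₀ (norm_nonneg _) h1 2
  nlinarith [sq_nonneg (‖u s‖ - 3 * ∫ x in s..t, ‖-Complex.I * u' x + b x * u x‖)]

/-- The Euclidean plane. -/
abbrev Plane := EuclideanSpace ℝ (Fin 2)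

/-- Counterclockwise rotation by a right angle. -/
noncomputable def perp : Plane →ₗ[ℝ] Plane where
  toFun v := !₂[-v 1, v 0]
  map_add' v w := by ext i; fin_cases i <;> simp; ring
  map_smul' c v := by ext i; fin_cases i <;> simp

@[simp] lemma perp_apply_zero (v : Plane) : perp v 0 = -v 1 := rfl

@[simp] lemma perp_apply_one (v : Plane) : perp v 1 = v 0 := rfl

lemma Plane.norm_sq_eq (v : Plane) : ‖v‖ ^ 2 = v 0 ^ 2 + v 1 ^ 2 := by
  simp [EuclideanSpace.norm_sq_eq]

@[fun_prop] lemma continuous_perp : Continuous perp := perp.continuous_of_finiteDimensional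

lemma norm_add_perp_sq (c d : ℝ) (v : Plane) :
    ‖c • v + d • perp v‖ ^ 2 = (c ^ 2 + d ^ 2) * ‖v‖ ^ 2 := by
  simp [Plane.norm_sq_eq]
  ring

/-- The midpoint of the particles `j` and `k`. -/
noncomputable def pairMid (j k : Fin N) (x : Fin N → Plane) : Plane := (1 / 2 : ℝ) • (x j + x k)

/-- Half of the relative position of the particles `j` and `k`. -/
noncomputable def pairRel (j k : Fin N) (x : Fin N → Plane) : Plane := (1 / 2 : ℝ) • (x j - x k)

@[fun_prop] lemma continuous_pairMid (j k : Fin N) : Continuous (pairMid j k) := by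
  unfold pairMid; fun_prop

@[fun_prop] lemma continuous_pairRel (j k : Fin N) : Continuous (pairRel j k) := by
  unfold pairRel; fun_prop

lemma pairMid_add_pairRel (j k : Fin N) (x : Fin N → Plane) :
    pairMid j k x + pairRel j k x = x j := by
  unfold pairMid pairRel; module

lemma pairMid_sub_pairRel (j k : Fin N) (x : Fin N → Plane) :
    pairMid j k x - pairRel j k x = x k := by
  unfold pairMid pairRel; module

lemma norm_sq_pairMid_add_norm_sq_pairRel (j k : Fin N) (x : Fin N → Plane) (y : Plane) :
    ‖pairMid j k x - y‖ ^ 2 + ‖pairRel j k x‖ ^ 2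
      = (‖x j - y‖ ^ 2 + ‖x k - y‖ ^ 2) / 2 := by
  simp [Plane.norm_sq_eq, pairMid, pairRel]
  ring

/-- The linear map that acts on the relative position of the particles `j` and `k` as
multiplication by the complex number `c + id` and fixes their midpoint and all other particles. -/
noncomputable def pairTwist (j k : Fin N) (c d : ℝ) : (Fin N → Plane) →ₗ[ℝ] (Fin N → Plane) where
  toFun x := x + Pi.single j ((c - 1) • pairRel j k x + d • perp (pairRel j k x))
    - Pi.single k ((c - 1) • pairRel j k x + d • perp (pairRel j k x))
  map_add' x z := by
    ext l i
    simp only [pairRel, Pi.add_apply, Pi.sub_apply, Pi.single_apply, map_smul, map_sub, map_add]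
    split_ifs <;> simp <;> ring
  map_smul' a x := by
    ext l i
    simp only [pairRel, Pi.add_apply, Pi.sub_apply, Pi.single_apply, map_smul, map_sub,
      Pi.smul_apply, RingHom.id_apply]
    split_ifs <;> simp <;> ring

lemma pairTwist_apply (j k : Fin N) (c d : ℝ) (x : Fin N → Plane) : pairTwist j k c d x
    = x + Pi.single j ((c - 1) • pairRel j k x + d • perp (pairRel j k x))
      - Pi.single k ((c - 1) • pairRel j k x + d • perp (pairRel j k x)) := rfl

lemma pairTwist_apply_left {j k : Fin N} (hjk : j ≠ k) (c d : ℝ) (x : Fin N → Plane) :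
    pairTwist j k c d x j
      = pairMid j k x + (c • pairRel j k x + d • perp (pairRel j k x)) := by
  simp only [pairTwist_apply, Pi.add_apply, Pi.sub_apply, Pi.single_eq_same,
    Pi.single_eq_of_ne hjk]
  nth_rw 1 [← pairMid_add_pairRel j k x]
  module

lemma pairTwist_apply_right {j k : Fin N} (hjk : j ≠ k) (c d : ℝ) (x : Fin N → Plane) :
    pairTwist j k c d x k
      = pairMid j k x - (c • pairRel j k x + d • perp (pairRel j k x)) := by
  simp only [pairTwist_apply, Pi.add_apply, Pi.sub_apply, Pi.single_eq_same,
    Pi.single_eq_of_ne hjk.symm]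
  nth_rw 1 [← pairMid_sub_pairRel j k x]
  module

lemma pairTwist_apply_of_ne {j k l : Fin N} (hj : l ≠ j) (hk : l ≠ k) (c d : ℝ)
    (x : Fin N → Plane) : pairTwist j k c d x l = x l := by
  simp [pairTwist_apply, Pi.single_eq_of_ne hj, Pi.single_eq_of_ne hk]

lemma pairMid_pairTwist {j k : Fin N} (hjk : j ≠ k) (c d : ℝ) (x : Fin N → Plane) :
    pairMid j k (pairTwist j k c d x) = pairMid j k x := by
  rw [pairMid, pairTwist_apply_left hjk, pairTwist_apply_right hjk]
  module

lemma pairRel_pairTwist {j k : Fin N} (hjk : j ≠ k) (c d : ℝ) (x : Fin N → Plane) :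
    pairRel j k (pairTwist j k c d x) = c • pairRel j k x + d • perp (pairRel j k x) := by
  rw [pairRel, pairTwist_apply_left hjk, pairTwist_apply_right hjk]
  module

lemma norm_pairRel_pairTwist {j k : Fin N} (hjk : j ≠ k) {c d : ℝ} (hcd : c ^ 2 + d ^ 2 = 1)
    (x : Fin N → Plane) : ‖pairRel j k (pairTwist j k c d x)‖ = ‖pairRel j k x‖ := by
  have := norm_add_perp_sq c d (pairRel j k x)
  rw [hcd, one_mul, ← pairRel_pairTwist hjk] at this
  exact (sq_eq_sq₀ (norm_nonneg _) (norm_nonneg _)).1 this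

lemma sum_norm_sq_pairTwist {j k : Fin N} (hjk : j ≠ k) {c d : ℝ} (hcd : c ^ 2 + d ^ 2 = 1)
    (x : Fin N → Plane) : ∑ l, ‖pairTwist j k c d x l‖ ^ 2 = ∑ l, ‖x l‖ ^ 2 := by
  have hsplit : ∀ z : Fin N → Plane, ∑ l, ‖z l‖ ^ 2
      = 2 * (‖pairMid j k z‖ ^ 2 + ‖pairRel j k z‖ ^ 2)
        + ∑ l ∈ (Finset.univ.erase j).erase k, ‖z l‖ ^ 2 := fun z => by
    have := norm_sq_pairMid_add_norm_sq_pairRel j k z 0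
    simp only [sub_zero] at this
    rw [this, ← Finset.add_sum_erase _ _ (Finset.mem_univ j),
      ← Finset.add_sum_erase _ _ (Finset.mem_erase.2 ⟨hjk.symm, Finset.mem_univ k⟩)]
    ring
  rw [hsplit, hsplit, pairMid_pairTwist hjk, norm_pairRel_pairTwist hjk hcd]
  congr 1
  refine Finset.sum_congr rfl fun l hl => ?_
  simp only [Finset.mem_erase] at hl
  rw [pairTwist_apply_of_ne hl.2.1 hl.1]

/-- Rotating a pair of particles around its midpoint preserves Lebesgue measure. -/
lemma measurePreserving_pairTwist {j k : Fin N} (hjk : j ≠ k) {c d : ℝ}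
    (hcd : c ^ 2 + d ^ 2 = 1) :
    MeasurePreserving (pairTwist j k c d) (volume : Measure (Fin N → Plane)) volume := by
  have hcont : Continuous (pairTwist j k c d) :=
    (pairTwist j k c d).continuous_of_finiteDimensional
  refine ⟨hcont.measurable, ?_⟩
  have hdet : LinearMap.det (pairTwist j k c d) ≠ 0 := by
    rw [Ne, LinearMap.det_eq_zero_iff_ker_ne_bot, not_not, LinearMap.ker_eq_bot']
    intro x hx
    have h0 := sum_norm_sq_pairTwist hjk hcd x
    simp only [hx, Pi.zero_apply, norm_zero, ne_eq, OfNat.ofNat_ne_zero, not_false_eq_true,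
      zero_pow, Finset.sum_const_zero] at h0
    funext l
    have := (Finset.sum_eq_zero_iff_of_nonneg fun l _ => by positivity).1 h0.symm l
      (Finset.mem_univ l)
    simpa using this
  have hmap := Measure.map_linearMap_addHaar_eq_smul_addHaar
    (volume : Measure (Fin N → Plane)) hdet
  set U : Set (Fin N → Plane) := {x | ∑ l, ‖x l‖ ^ 2 < 1} with hU
  have hUo : IsOpen U := isOpen_lt (by fun_prop) continuous_const
  have hpos : volume U ≠ 0 := (hUo.measure_pos volume ⟨0, by simp [hU]⟩).ne'
  have hfin : volume U ≠ ⊤ := by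
    refine (Bornology.IsBounded.measure_lt_top
      (Metric.isBounded_closedBall.subset (t := Metric.closedBall 0 1) ?_)).ne
    intro x hx
    rw [mem_closedBall_zero_iff, pi_norm_le_iff_of_nonneg zero_le_one]
    intro l
    have h1 : ‖x l‖ ^ 2 ≤ ∑ l, ‖x l‖ ^ 2 :=
      Finset.single_le_sum (f := fun l => ‖x l‖ ^ 2) (fun _ _ => by positivity)
        (Finset.mem_univ l)
    have h2 : ∑ l, ‖x l‖ ^ 2 < 1 := hx
    nlinarith [norm_nonneg (x l)]
  have hinv : pairTwist j k c d ⁻¹' U = U := by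
    ext x
    simp [hU, sum_norm_sq_pairTwist hjk hcd]
  have hUmap := congrArg (fun μ : Measure (Fin N → Plane) => μ U) hmap
  simp only [Measure.smul_apply, smul_eq_mul] at hUmap
  rw [Measure.map_apply hcont.measurable hUo.measurableSet, hinv] at hUmap
  have hone : ENNReal.ofReal |(LinearMap.det (pairTwist j k c d))⁻¹| = 1 := by
    rw [← ENNReal.mul_right_inj hpos hfin, mul_one, mul_comm]
    exact hUmap.symm
  rw [hmap, hone, one_smul]

/-- The dilation of the particles `j` and `k` about the point `y` by the factor `t`. -/
noncomputable def pairDilate (j k : Fin N) (y : Plane) (t : ℝ) (x : Fin N → Plane) :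
    Fin N → Plane :=
  x + (t - 1) • (Pi.single j (x j - y) + Pi.single k (x k - y))

lemma pairDilate_apply_left {j k : Fin N} (hjk : j ≠ k) (y : Plane) (t : ℝ)
    (x : Fin N → Plane) : pairDilate j k y t x j = y + t • (x j - y) := by
  simp only [pairDilate, Pi.add_apply, Pi.smul_apply, Pi.single_eq_same, Pi.single_eq_of_ne hjk]
  module

lemma pairDilate_apply_right {j k : Fin N} (hjk : j ≠ k) (y : Plane) (t : ℝ)
    (x : Fin N → Plane) : pairDilate j k y t x k = y + t • (x k - y) := by
  simp only [pairDilate, Pi.add_apply, Pi.smul_apply, Pi.single_eq_same,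
    Pi.single_eq_of_ne hjk.symm]
  module

lemma pairDilate_apply_of_ne {j k l : Fin N} (hj : l ≠ j) (hk : l ≠ k) (y : Plane) (t : ℝ)
    (x : Fin N → Plane) : pairDilate j k y t x l = x l := by
  simp [pairDilate, Pi.single_eq_of_ne hj, Pi.single_eq_of_ne hk]

lemma continuous_pairDilate (j k : Fin N) (y : Plane) :
    Continuous fun p : ℝ × (Fin N → Plane) => pairDilate j k y p.1 p.2 := by
  unfold pairDilate
  have h : ∀ l : Fin N, Continuous fun p : ℝ × (Fin N → Plane) =>
      (Pi.single l (p.2 l - y) : Fin N → Plane) := fun l =>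
    (continuous_single l).comp (by fun_prop)
  exact continuous_snd.add ((by fun_prop : Continuous fun p : ℝ × (Fin N → Plane) =>
    p.1 - 1).smul ((h j).add (h k)))

lemma lintegral_comp_pairDilate {j k : Fin N} (hjk : j ≠ k) (y : Plane) {t : ℝ} (ht : 0 < t)
    {F : (Fin N → Plane) → ENNReal} (hF : Measurable F) :
    ∫⁻ x, F (pairDilate j k y t x) = ENNReal.ofReal ((t ^ 4)⁻¹) * ∫⁻ x, F x := by
  set L : (Fin N → Plane) →ₗ[ℝ] (Fin N → Plane) := LinearMap.pi fun i =>
    ((if i = j ∨ i = k then t else 1) • (LinearMap.id : Plane →ₗ[ℝ] Plane)) ∘ₗ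
      LinearMap.proj i with hL
  have hdet : LinearMap.det L = t ^ 4 := by
    rw [hL, LinearMap.det_pi]
    simp only [LinearMap.det_smul, LinearMap.det_id, mul_one, finrank_euclideanSpace,
      Fintype.card_fin, ite_pow, one_pow]
    rw [Finset.prod_ite, Finset.prod_const_one, mul_one, Finset.prod_const]
    have : Finset.univ.filter (fun i => i = j ∨ i = k) = {j, k} := by
      ext i; simp
    rw [this, Finset.card_pair hjk]
    ring
  set b : Fin N → Plane := fun i => if i = j ∨ i = k then (1 - t) • y else 0 with hb
  have hdil : ∀ x, pairDilate j k y t x = L x + b := fun x => by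
    funext l
    by_cases hj : l = j
    · subst hj
      rw [pairDilate_apply_left hjk]
      simp [hL, hb]
      module
    by_cases hk : l = k
    · subst hk
      rw [pairDilate_apply_right hjk]
      simp [hL, hb]
      module
    rw [pairDilate_apply_of_ne hj hk]
    simp [hL, hb, hj, hk]
  have hmap := Measure.map_linearMap_addHaar_eq_smul_addHaar
    (volume : Measure (Fin N → Plane)) (f := L) (by rw [hdet]; positivity)
  rw [hdet, abs_of_pos (by positivity)] at hmap
  have hLm : Measurable L := L.continuous_of_finiteDimensional.measurable
  calc ∫⁻ x, F (pairDilate j k y t x) = ∫⁻ x, F (L x + b) := by simp only [hdil]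
    _ = ∫⁻ z, F (z + b) ∂(Measure.map L volume) :=
        (lintegral_map (hF.comp (measurable_add_const b)) hLm).symm
    _ = _ := by rw [hmap, lintegral_smul_measure, lintegral_add_right_eq_self, smul_eq_mul]

lemma anyonA_eq_perp (α : ℝ) (x : Fin N → Plane) (j : Fin N) (i : Fin 2) :
    anyonA α x j i = α * ∑ l ∈ Finset.univ.erase j, perp (x j - x l) i / ‖x j - x l‖ ^ 2 := by
  unfold anyonA
  rw [Finset.filter_ne']
  congr 1
  refine Finset.sum_congr rfl fun l _ => ?_
  fin_cases i
  · simp only [Fin.zero_eta, if_true, perp_apply_zero, PiLp.sub_apply]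
  · simp

lemma continuousAt_anyonA (α : ℝ) {x : Fin N → Plane} {j : Fin N}
    (hx : ∀ l, j ≠ l → x j ≠ x l) (i : Fin 2) :
    ContinuousAt (fun z : Fin N → Plane => anyonA α z j i) x := by
  simp only [anyonA_eq_perp]
  refine continuousAt_const.mul (tendsto_finsetSum _ fun l hl => ?_)
  refine ContinuousAt.div (Continuous.continuousAt (by fun_prop))
    (Continuous.continuousAt (by fun_prop)) ?_
  have := hx l (Finset.ne_of_mem_erase hl).symm
  simpa [sub_eq_zero] using this

lemma anyonD_eq_zero_of_notMem_tsupport (α : ℝ) {ψ : (Fin N → Plane) → ℂ} {x : Fin N → Plane}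
    (hx : x ∉ tsupport ψ) (j : Fin N) (i : Fin 2) : anyonD α ψ x j i = 0 := by
  rw [anyonD, image_eq_zero_of_notMem_tsupport hx, fderiv_of_notMem_tsupport ℝ hx]
  simp

lemma continuous_anyonD (α : ℝ) {ψ : (Fin N → Plane) → ℂ} (hψ : ContDiff ℝ (⊤ : ℕ∞) ψ)
    (hsupp : ∀ x ∈ tsupport ψ, ∀ j k : Fin N, j ≠ k → x j ≠ x k) (j : Fin N) (i : Fin 2) :
    Continuous fun x => anyonD α ψ x j i := by
  refine continuous_iff_continuousAt.2 fun x => ?_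
  by_cases hx : x ∈ tsupport ψ
  · have h1 : Continuous (fderiv ℝ ψ) := hψ.continuous_fderiv (by simp)
    have h2 := continuousAt_anyonA α (hsupp x hx j) i
    unfold anyonD
    exact (continuousAt_const.mul (h1.clm_apply continuous_const).continuousAt).add
      ((Complex.continuous_ofReal.continuousAt.comp h2).mul hψ.continuous.continuousAt)
  · refine (continuousAt_const (y := (0 : ℂ))).congr ?_
    filter_upwards [(isClosed_tsupport ψ).isOpen_compl.mem_nhds hx] with z hz
    exact (anyonD_eq_zero_of_notMem_tsupport α hz j i).symm

lemma sum_mul_anyonD (α : ℝ) (ψ : (Fin N → Plane) → ℂ) (x : Fin N → Plane) (j : Fin N)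
    (v : Plane) : ∑ i, (v i : ℂ) * anyonD α ψ x j i
      = -Complex.I * fderiv ℝ ψ x (Pi.single j v)
        + ((∑ i, v i * anyonA α x j i : ℝ) : ℂ) * ψ x := by
  have hv : Pi.single j v = v 0 • (Pi.single j (EuclideanSpace.single 0 (1 : ℝ)) : Fin N → Plane)
      + v 1 • (Pi.single j (EuclideanSpace.single 1 (1 : ℝ)) : Fin N → Plane) := by
    rw [← Pi.single_smul, ← Pi.single_smul, ← Pi.single_add]
    congr 1
    ext i
    fin_cases i <;> simp
  rw [hv, map_add, map_smul, map_smul]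
  simp only [anyonD, Fin.sum_univ_two, Complex.real_smul]
  push_cast
  ring

lemma norm_sq_sum_mul_le (v : Plane) (w : Fin 2 → ℂ) :
    ‖∑ i, (v i : ℂ) * w i‖ ^ 2 ≤ ‖v‖ ^ 2 * ∑ i, ‖w i‖ ^ 2 := by
  have h : ‖∑ i, (v i : ℂ) * w i‖ ≤ |v 0| * ‖w 0‖ + |v 1| * ‖w 1‖ := by
    refine (norm_sum_le _ _).trans_eq ?_
    simp [Fin.sum_univ_two]
  have h' := pow_le_pow_left₀ (norm_nonneg _) h 2
  rw [Plane.norm_sq_eq, Fin.sum_univ_two (f := fun i => ‖w i‖ ^ 2), ← sq_abs (v 0), ← sq_abs (v 1)]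
  nlinarith [sq_nonneg (|v 0| * ‖w 1‖ - |v 1| * ‖w 0‖)]

lemma norm_sq_add_sum_mul_le (v v' : Plane) (w w' : Fin 2 → ℂ) :
    ‖∑ i, (v i : ℂ) * w i + ∑ i, (v' i : ℂ) * w' i‖ ^ 2
      ≤ (‖v‖ ^ 2 + ‖v'‖ ^ 2) * (∑ i, ‖w i‖ ^ 2 + ∑ i, ‖w' i‖ ^ 2) := by
  set a := √(∑ i, ‖w i‖ ^ 2)
  set a' := √(∑ i, ‖w' i‖ ^ 2)
  have ha : a ^ 2 = ∑ i, ‖w i‖ ^ 2 := Real.sq_sqrt (by positivity)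
  have ha' : a' ^ 2 = ∑ i, ‖w' i‖ ^ 2 := Real.sq_sqrt (by positivity)
  have h1 : ‖∑ i, (v i : ℂ) * w i‖ ≤ ‖v‖ * a := by
    refine (sq_le_sq₀ (norm_nonneg _) (by positivity)).1 ?_
    rw [mul_pow, ha]
    exact norm_sq_sum_mul_le v w
  have h2 : ‖∑ i, (v' i : ℂ) * w' i‖ ≤ ‖v'‖ * a' := by
    refine (sq_le_sq₀ (norm_nonneg _) (by positivity)).1 ?_
    rw [mul_pow, ha']
    exact norm_sq_sum_mul_le v' w'
  have h' := pow_le_pow_left₀ (norm_nonneg _) ((norm_add_le _ _).trans (add_le_add h1 h2)) 2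
  rw [← ha, ← ha']
  nlinarith [sq_nonneg (‖v‖ * a' - ‖v'‖ * a)]

/-- The complex number with the coordinates of a point of the plane. -/
def Plane.toComplex (v : Plane) : ℂ := ⟨v 0, v 1⟩

lemma Plane.norm_toComplex (v : Plane) : ‖v.toComplex‖ = ‖v‖ := by
  refine (sq_eq_sq₀ (norm_nonneg _) (norm_nonneg _)).1 ?_
  rw [Complex.sq_norm, Complex.normSq_apply, Plane.norm_sq_eq, Plane.toComplex]
  ring

/-- The rotation of `v` by the angle `φ`. -/
noncomputable def Plane.rotate (v : Plane) (φ : ℝ) : Plane :=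
  Real.cos φ • v + Real.sin φ • perp v

lemma Plane.toComplex_rotate (v : Plane) (φ : ℝ) :
    (v.rotate φ).toComplex = Complex.exp (φ * Complex.I) * v.toComplex := by
  rw [Complex.exp_mul_I]
  apply Complex.ext <;>
    simp [Plane.toComplex, Plane.rotate, Complex.cos_ofReal_re, Complex.sin_ofReal_re]
  ring

lemma Plane.rotate_add_pi (v : Plane) (φ : ℝ) : v.rotate (φ + Real.pi) = -v.rotate φ := by
  simp only [Plane.rotate, Real.cos_add_pi, Real.sin_add_pi]
  module

lemma Plane.norm_rotate (v : Plane) (φ : ℝ) : ‖v.rotate φ‖ = ‖v‖ := by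
  have := norm_add_perp_sq (Real.cos φ) (Real.sin φ) v
  rw [Real.cos_sq_add_sin_sq, one_mul] at this
  exact (sq_eq_sq₀ (norm_nonneg _) (norm_nonneg _)).1 this

lemma norm_perp (v : Plane) : ‖perp v‖ = ‖v‖ := by
  refine (sq_eq_sq₀ (norm_nonneg _) (norm_nonneg _)).1 ?_
  simp [Plane.norm_sq_eq]
  ring

lemma sum_perp_mul_perp_div (m v : Plane) :
    ∑ i, perp v i * (perp (m + v) i / ‖m + v‖ ^ 2)
      = (v.toComplex / (v.toComplex + m.toComplex)).re := by
  have : Complex.normSq (v.toComplex + m.toComplex) = ‖m + v‖ ^ 2 := by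
    simp [Complex.normSq_apply, Plane.toComplex, Plane.norm_sq_eq]
    ring
  rw [Complex.div_re, this]
  simp [Fin.sum_univ_two, Plane.toComplex]
  ring

/-- Real part of the logarithmic differential that describes the angular motion around a point. -/
noncomputable def windingDensity (ζ : ℂ) (φ : ℝ) : ℝ :=
  (Complex.exp (φ * Complex.I) / (Complex.exp (φ * Complex.I) + ζ)).re

lemma continuous_windingDensity {ζ : ℂ} (hζ : ‖ζ‖ ≠ 1) : Continuous (windingDensity ζ) := by
  refine Complex.continuous_re.comp (Continuous.div (by fun_prop) (by fun_prop) fun φ h => hζ ?_)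
  rw [← Complex.norm_exp_ofReal_mul_I φ, eq_neg_of_add_eq_zero_left h, norm_neg]

lemma integral_windingDensity_add_shift {ζ : ℂ} (hζ : ‖ζ‖ ≠ 1) :
    ∃ m : ℕ, m ≤ 1 ∧ ∫ φ in (0 : ℝ)..Real.pi,
      (windingDensity ζ φ + windingDensity ζ (φ + Real.pi)) = 2 * Real.pi * m := by
  obtain ⟨m, hm, h⟩ := integral_unit_circle_winding hζ
  have hc := continuous_windingDensity hζ
  refine ⟨m, hm, ?_⟩
  rw [← h, intervalIntegral.integral_add (hc.intervalIntegrable _ _)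
    (Continuous.intervalIntegrable (by fun_prop) _ _),
    intervalIntegral.integral_comp_add_right (windingDensity ζ), zero_add, ← two_mul,
    intervalIntegral.integral_add_adjacent_intervals (hc.intervalIntegrable _ _)
      (hc.intervalIntegrable _ _)]
  rfl

lemma sum_perp_mul_perp_rotate {v : Plane} (hv : v ≠ 0) (m : Plane) (φ : ℝ) :
    ∑ i, perp (v.rotate φ) i * (perp (m + v.rotate φ) i / ‖m + v.rotate φ‖ ^ 2)
      = windingDensity (m.toComplex / v.toComplex) φ := by
  have hv' : v.toComplex ≠ 0 := by rwa [← norm_ne_zero_iff, Plane.norm_toComplex, norm_ne_zero_iff]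
  rw [sum_perp_mul_perp_div, Plane.toComplex_rotate, windingDensity]
  congr 1
  rw [← mul_div_mul_right _ (Complex.exp (φ * Complex.I) + m.toComplex / v.toComplex) hv', add_mul,
    div_mul_cancel₀ _ hv']

/-- Rotation of the particles `j` and `k` around their midpoint by the angle `φ`. -/
noncomputable def pairRotate (j k : Fin N) (φ : ℝ) (x : Fin N → Plane) : Fin N → Plane :=
  pairTwist j k (Real.cos φ) (Real.sin φ) x

lemma pairRotate_apply_left {j k : Fin N} (hjk : j ≠ k) (φ : ℝ) (x : Fin N → Plane) :
    pairRotate j k φ x j = pairMid j k x + (pairRel j k x).rotate φ :=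
  pairTwist_apply_left hjk _ _ x

lemma pairRotate_apply_right {j k : Fin N} (hjk : j ≠ k) (φ : ℝ) (x : Fin N → Plane) :
    pairRotate j k φ x k = pairMid j k x - (pairRel j k x).rotate φ :=
  pairTwist_apply_right hjk _ _ x

lemma pairRotate_apply_of_ne {j k l : Fin N} (hj : l ≠ j) (hk : l ≠ k) (φ : ℝ)
    (x : Fin N → Plane) : pairRotate j k φ x l = x l :=
  pairTwist_apply_of_ne hj hk _ _ x

lemma continuous_pairTwist_comp {X : Type*} [TopologicalSpace X] (j k : Fin N) {c d : X → ℝ}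
    {x : X → Fin N → Plane} (hc : Continuous c) (hd : Continuous d) (hx : Continuous x) :
    Continuous fun t => pairTwist j k (c t) (d t) (x t) := by
  simp only [pairTwist_apply]
  have h : Continuous fun t =>
      (c t - 1) • pairRel j k (x t) + d t • perp (pairRel j k (x t)) := by fun_prop
  exact (hx.add ((continuous_single j).comp h)).sub ((continuous_single k).comp h)

lemma continuous_pairRotate {X : Type*} [TopologicalSpace X] (j k : Fin N) {φ : X → ℝ}
    {x : X → Fin N → Plane} (hφ : Continuous φ) (hx : Continuous x) :
    Continuous fun t => pairRotate j k (φ t) (x t) :=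
  continuous_pairTwist_comp j k (Real.continuous_cos.comp hφ) (Real.continuous_sin.comp hφ) hx

lemma pairRotate_zero (j k : Fin N) (x : Fin N → Plane) : pairRotate j k 0 x = x := by
  simp [pairRotate, pairTwist_apply]

lemma pairRotate_pi {j k : Fin N} (hjk : j ≠ k) (x : Fin N → Plane) :
    pairRotate j k Real.pi x = x ∘ Equiv.swap j k := by
  funext l
  by_cases hj : l = j
  · subst hj
    simp [pairRotate, pairTwist_apply_left hjk, ← pairMid_sub_pairRel l k x, sub_eq_add_neg]
  by_cases hk : l = k
  · subst hk
    simp [pairRotate, pairTwist_apply_right hjk, ← pairMid_add_pairRel j l x]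
  rw [pairRotate_apply_of_ne hj hk, Function.comp_apply, Equiv.swap_apply_of_ne_of_ne hj hk]

lemma hasDerivAt_pairRotate (j k : Fin N) (x : Fin N → Plane) (φ : ℝ) :
    HasDerivAt (fun φ => pairRotate j k φ x)
      (Pi.single j (perp ((pairRel j k x).rotate φ))
        - Pi.single k (perp ((pairRel j k x).rotate φ))) φ := by
  set ρ := pairRel j k x
  have hpp : perp (perp ρ) = -ρ := by
    ext i
    fin_cases i <;> simp
  have h : HasDerivAt (fun φ : ℝ => (Real.cos φ - 1) • ρ + Real.sin φ • perp ρ)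
      (perp (ρ.rotate φ)) φ := by
    have h1 := (((Real.hasDerivAt_cos φ).sub_const 1).smul_const ρ).add
      ((Real.hasDerivAt_sin φ).smul_const (perp ρ))
    have e : perp (ρ.rotate φ) = (-Real.sin φ) • ρ + Real.cos φ • perp ρ := by
      simp only [Plane.rotate, map_add, map_smul, hpp]
      module
    rw [e]
    exact h1
  have hs : ∀ l : Fin N, HasDerivAt (fun φ : ℝ => (Pi.single l
      ((Real.cos φ - 1) • ρ + Real.sin φ • perp ρ) : Fin N → Plane))
      (Pi.single l (perp (ρ.rotate φ))) φ := fun l =>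
    (ContinuousLinearMap.single ℝ (fun _ : Fin N => Plane) l).hasFDerivAt.comp_hasDerivAt φ h
  have := ((hasDerivAt_const φ x).add (hs j)).sub (hs k)
  rw [zero_add] at this
  exact this

/-- The angular component of the anyonic gauge potential along the rotation of a pair. -/
lemma sum_perp_mul_anyonA_sub (α : ℝ) {j k : Fin N} (hjk : j ≠ k) {x : Fin N → Plane}
    (hρ : pairRel j k x ≠ 0) (φ : ℝ) :
    ∑ i, perp ((pairRel j k x).rotate φ) i
        * (anyonA α (pairRotate j k φ x) j i - anyonA α (pairRotate j k φ x) k i)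
      = α * (1 + ∑ l ∈ (Finset.univ.erase j).erase k,
        (windingDensity ((pairMid j k x - x l).toComplex / (pairRel j k x).toComplex) φ
          + windingDensity ((pairMid j k x - x l).toComplex / (pairRel j k x).toComplex)
            (φ + Real.pi))) := by
  set ρ := pairRel j k x with hρdef
  set X := pairMid j k x with hX
  set z := pairRotate j k φ x with hz
  set r := ρ.rotate φ with hr
  have hzj : z j = X + r := pairRotate_apply_left hjk φ x
  have hzk : z k = X - r := pairRotate_apply_right hjk φ x
  have hzl : ∀ l ∈ (Finset.univ.erase j).erase k, z l = x l := fun l hl => by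
    simp only [Finset.mem_erase] at hl
    exact pairRotate_apply_of_ne hl.2.1 hl.1 φ x
  have hr0 : r.toComplex ≠ 0 := by
    rwa [← norm_ne_zero_iff, Plane.norm_toComplex, hr, Plane.norm_rotate, norm_ne_zero_iff]
  have hhalf : ∀ v : Plane, v.toComplex ≠ 0 →
      ∑ i, perp v i * (perp (v + v) i / ‖v + v‖ ^ 2) = 1 / 2 := fun v hv => by
    rw [sum_perp_mul_perp_div, ← two_mul, div_mul_cancel_right₀ hv]
    norm_num
  have hA : ∀ m : Fin N, ∑ i, perp r i * anyonA α z m i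
      = α * ∑ l ∈ Finset.univ.erase m,
        ∑ i, perp r i * (perp (z m - z l) i / ‖z m - z l‖ ^ 2) := fun m => by
    simp only [anyonA_eq_perp, Fin.sum_univ_two, Finset.sum_add_distrib, ← Finset.mul_sum]
    ring
  have hneg : ∀ w : Plane, ∑ i, perp r i * (perp w i / ‖w‖ ^ 2)
      = -∑ i, perp (-r) i * (perp w i / ‖w‖ ^ 2) := fun w => by
    simp [Fin.sum_univ_two]
  have hj : ∑ i, perp r i * anyonA α z j i = α * (1 / 2 + ∑ l ∈ (Finset.univ.erase j).erase k,
      windingDensity ((X - x l).toComplex / ρ.toComplex) φ) := by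
    rw [hA, ← Finset.add_sum_erase _ _ (Finset.mem_erase.2 ⟨hjk.symm, Finset.mem_univ k⟩)]
    congr 2
    · rw [← hhalf r hr0, hzj, hzk]
      simp only [show X + r - (X - r) = r + r by abel]
    · refine Finset.sum_congr rfl fun l hl => ?_
      rw [hzj, hzl l hl, ← sum_perp_mul_perp_rotate hρ (X - x l) φ,
        show X + r - x l = X - x l + r by abel]
  have hk : ∑ i, perp r i * anyonA α z k i = -(α * (1 / 2
      + ∑ l ∈ (Finset.univ.erase j).erase k,
        windingDensity ((X - x l).toComplex / ρ.toComplex) (φ + Real.pi))) := by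
    rw [hA, ← mul_neg, neg_add, ← Finset.sum_neg_distrib,
      ← Finset.add_sum_erase _ _ (Finset.mem_erase.2 ⟨hjk, Finset.mem_univ j⟩),
      Finset.erase_right_comm]
    congr 2
    · have hr0' : (-r).toComplex ≠ 0 := by
        rwa [← norm_ne_zero_iff, Plane.norm_toComplex, norm_neg, ← Plane.norm_toComplex,
          norm_ne_zero_iff]
      rw [hneg, ← hhalf (-r) hr0', hzj, hzk]
      simp only [show X - r - (X + r) = -r + -r by abel]
    · refine Finset.sum_congr rfl fun l hl => ?_
      rw [hneg, hzk, hzl l hl, ← sum_perp_mul_perp_rotate hρ (X - x l) (φ + Real.pi),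
        Plane.rotate_add_pi, show X - r - x l = X - x l + -r by abel]
  simp only [mul_sub, Finset.sum_sub_distrib]
  rw [hj, hk, Finset.sum_add_distrib]
  ring

section Hardy

variable {α C : ℝ} {ψ : (Fin N → Plane) → ℂ}

/-- The squared modulus of the relative covariant derivative `D_jψ - D_kψ`. -/
noncomputable def relEnergy (α : ℝ) (ψ : (Fin N → Plane) → ℂ) (j k : Fin N)
    (x : Fin N → Plane) : ℝ :=
  ∑ i, ‖anyonD α ψ x j i - anyonD α ψ x k i‖ ^ 2

/-- Magnetic Hardy inequality along the rotation orbit of a pair, when no other particle meets the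
orbit. -/
lemma hardy_orbit_of_generic (hψ : ContDiff ℝ (⊤ : ℕ∞) ψ)
    (hsym : ∀ (σ : Equiv.Perm (Fin N)) (x : Fin N → Plane), ψ (x ∘ σ) = ψ x)
    (hC : ∀ p : ℕ, p ≤ N - 2 → ∀ q : ℤ, C ^ 2 ≤ ((2 * (p : ℝ) + 1) * α - 2 * q) ^ 2)
    {j k : Fin N} (hjk : j ≠ k) {x : Fin N → Plane} (hρ : pairRel j k x ≠ 0)
    (hgen : ∀ l, ‖pairMid j k x - x l‖ ≠ ‖pairRel j k x‖ ∨ l = j ∨ l = k)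
    (hcont : Continuous (relEnergy α ψ j k)) :
    C ^ 2 * ∫ φ in (0 : ℝ)..Real.pi, ‖ψ (pairRotate j k φ x)‖ ^ 2
      ≤ ‖pairRel j k x‖ ^ 2 * ∫ φ in (0 : ℝ)..Real.pi, relEnergy α ψ j k (pairRotate j k φ x) := by
  set ρ := pairRel j k x with hρdef
  set ζ : Fin N → ℂ := fun l => (pairMid j k x - x l).toComplex / ρ.toComplex with hζdef
  set O := (Finset.univ.erase j).erase k with hO
  have hζ : ∀ l ∈ O, ‖ζ l‖ ≠ 1 := fun l hl h => by
    simp only [hO, Finset.mem_erase] at hl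
    rw [hζdef, norm_div, Plane.norm_toComplex, Plane.norm_toComplex,
      div_eq_one_iff_eq (norm_ne_zero_iff.2 hρ)] at h
    rcases hgen l with h' | h' | h'
    exacts [h' h, hl.2.1 h', hl.1 h']
  set a : ℝ → ℝ := fun φ => α * (1 + ∑ l ∈ O,
    (windingDensity (ζ l) φ + windingDensity (ζ l) (φ + Real.pi))) with hadef
  have hwc : ∀ l ∈ O, Continuous fun φ =>
      windingDensity (ζ l) φ + windingDensity (ζ l) (φ + Real.pi) := fun l hl =>
    (continuous_windingDensity (hζ l hl)).add
      ((continuous_windingDensity (hζ l hl)).comp (by fun_prop))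
  have hac : Continuous a :=
    continuous_const.mul (continuous_const.add (continuous_finsetSum _ hwc))
  have hwind : ∀ l, ∃ m : ℕ, m ≤ 1 ∧ (l ∈ O → ∫ φ in (0 : ℝ)..Real.pi,
      (windingDensity (ζ l) φ + windingDensity (ζ l) (φ + Real.pi)) = 2 * Real.pi * m) := by
    intro l
    by_cases hl : l ∈ O
    · obtain ⟨m, h1, h2⟩ := integral_windingDensity_add_shift (hζ l hl)
      exact ⟨m, h1, fun _ => h2⟩
    · exact ⟨0, zero_le_one, fun h => absurd h hl⟩
  choose m hm1 hm using hwind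
  set p : ℕ := ∑ l ∈ O, m l with hp
  have hpN : p ≤ N - 2 := by
    calc p ≤ ∑ l ∈ O, 1 := Finset.sum_le_sum fun l _ => hm1 l
      _ = N - 2 := by
        rw [Finset.sum_const, smul_eq_mul, mul_one, hO, Finset.card_erase_of_mem
          (Finset.mem_erase.2 ⟨hjk.symm, Finset.mem_univ k⟩),
          Finset.card_erase_of_mem (Finset.mem_univ j), Finset.card_univ, Fintype.card_fin]
        omega
  have hInt : ∫ φ in (0 : ℝ)..Real.pi, a φ = Real.pi * ((2 * (p : ℝ) + 1) * α) := by
    rw [hadef, intervalIntegral.integral_const_mul, intervalIntegral.integral_add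
      (Continuous.intervalIntegrable (by fun_prop) _ _)
      ((continuous_finsetSum _ hwc).intervalIntegrable _ _),
      intervalIntegral.integral_finsetSum fun l hl => (hwc l hl).intervalIntegrable _ _,
      Finset.sum_congr rfl fun l hl => hm l hl, ← Finset.mul_sum, ← Nat.cast_sum]
    simp only [intervalIntegral.integral_const, sub_zero, smul_eq_mul, mul_one, ← hp]
    ring
  have hzc : Continuous fun φ => pairRotate j k φ x :=
    continuous_pairRotate j k continuous_id continuous_const
  have hrc : Continuous fun φ => perp (ρ.rotate φ) := by unfold Plane.rotate; fun_prop
  have hfc : Continuous (fderiv ℝ ψ) := hψ.continuous_fderiv (by simp)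
  have key := magnetic_circle_poincare (u := fun φ => ψ (pairRotate j k φ x))
    (u' := fun φ => fderiv ℝ ψ (pairRotate j k φ x)
      (Pi.single j (perp (ρ.rotate φ)) - Pi.single k (perp (ρ.rotate φ)))) (a := a)
    (fun φ => ((hψ.differentiable (by simp)) _).hasFDerivAt.comp_hasDerivAt φ
      (hasDerivAt_pairRotate j k x φ))
    ((hfc.comp hzc).clm_apply
      (((continuous_single j).comp hrc).sub ((continuous_single k).comp hrc)))
    hac (by simp only [pairRotate_pi hjk, pairRotate_zero, hsym]) hInt (hC p hpN)
  refine key.trans ?_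
  have hD : ∀ φ, -Complex.I * fderiv ℝ ψ (pairRotate j k φ x)
      (Pi.single j (perp (ρ.rotate φ)) - Pi.single k (perp (ρ.rotate φ)))
      + a φ * ψ (pairRotate j k φ x)
      = ∑ i, (perp (ρ.rotate φ) i : ℂ) * (anyonD α ψ (pairRotate j k φ x) j i
        - anyonD α ψ (pairRotate j k φ x) k i) := fun φ => by
    simp only [mul_sub, Finset.sum_sub_distrib]
    rw [sum_mul_anyonD, sum_mul_anyonD, hadef]
    simp only [hζdef, hρdef, hO]
    rw [← sum_perp_mul_anyonA_sub α hjk hρ φ, map_sub]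
    simp only [mul_sub, Finset.sum_sub_distrib]
    push_cast
    ring
  simp only [hD]
  have hDc : Continuous fun φ => ‖∑ i, (perp (ρ.rotate φ) i : ℂ) *
      (anyonD α ψ (pairRotate j k φ x) j i - anyonD α ψ (pairRotate j k φ x) k i)‖ ^ 2 := by
    simp only [← hD]
    have h1 := (hfc.comp hzc).clm_apply
      (((continuous_single (A := fun _ : Fin N => Plane) j).comp hrc).sub
        ((continuous_single (A := fun _ : Fin N => Plane) k).comp hrc))
    exact ((continuous_const.mul h1).add
      ((Complex.continuous_ofReal.comp hac).mul (hψ.continuous.comp hzc))).norm.pow 2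
  rw [← intervalIntegral.integral_const_mul]
  refine intervalIntegral.integral_mono_on Real.pi_pos.le (hDc.intervalIntegrable _ _)
    ((continuous_const.mul (hcont.comp hzc)).intervalIntegrable _ _) fun φ _ => ?_
  refine (norm_sq_sum_mul_le _ _).trans_eq ?_
  rw [norm_perp, Plane.norm_rotate]
  rfl

lemma continuous_relEnergy (hψ : ContDiff ℝ (⊤ : ℕ∞) ψ)
    (hsupp : ∀ x ∈ tsupport ψ, ∀ j k : Fin N, j ≠ k → x j ≠ x k) (j k : Fin N) :
    Continuous (relEnergy α ψ j k) :=
  continuous_finsetSum _ fun i _ => ((continuous_anyonD α hψ hsupp j i).sub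
    (continuous_anyonD α hψ hsupp k i)).norm.pow 2

/-- Magnetic Hardy inequality along the rotation orbit of a pair. -/
lemma hardy_orbit (hψ : ContDiff ℝ (⊤ : ℕ∞) ψ)
    (hsym : ∀ (σ : Equiv.Perm (Fin N)) (x : Fin N → Plane), ψ (x ∘ σ) = ψ x)
    (hsupp : ∀ x ∈ tsupport ψ, ∀ j k : Fin N, j ≠ k → x j ≠ x k)
    (hC : ∀ p : ℕ, p ≤ N - 2 → ∀ q : ℤ, C ^ 2 ≤ ((2 * (p : ℝ) + 1) * α - 2 * q) ^ 2)
    {j k : Fin N} (hjk : j ≠ k) (x : Fin N → Plane) :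
    C ^ 2 * ∫ φ in (0 : ℝ)..Real.pi, ‖ψ (pairRotate j k φ x)‖ ^ 2
      ≤ ‖pairRel j k x‖ ^ 2 * ∫ φ in (0 : ℝ)..Real.pi, relEnergy α ψ j k (pairRotate j k φ x) := by
  have hcont := continuous_relEnergy (α := α) hψ hsupp j k
  by_cases hρ : pairRel j k x = 0
  · have h0 : ∀ φ, ψ (pairRotate j k φ x) = 0 := fun φ => by
      refine image_eq_zero_of_notMem_tsupport fun h => hsupp _ h j k hjk ?_
      rw [pairRotate_apply_left hjk, pairRotate_apply_right hjk, hρ]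
      simp [Plane.rotate]
    simp [h0, hρ]
  set F : ℝ → Fin N → Plane := fun s => pairTwist j k s 0 x with hF
  have hFc : Continuous F := 
    continuous_pairTwist_comp j k continuous_id continuous_const continuous_const
  have hF1 : F 1 = x := by simp [hF, pairTwist_apply]
  have hFφ : Continuous fun p : ℝ × ℝ => pairRotate j k p.2 (F p.1) :=
    continuous_pairRotate j k continuous_snd (hFc.comp continuous_fst)
  have hrel : ∀ s, pairRel j k (F s) = s • pairRel j k x := fun s => by
    simp [hF, pairRel_pairTwist hjk]
  have hclosed : IsClosed {s : ℝ | C ^ 2 * ∫ φ in (0 : ℝ)..Real.pi,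
      ‖ψ (pairRotate j k φ (F s))‖ ^ 2 ≤ ‖pairRel j k (F s)‖ ^ 2
        * ∫ φ in (0 : ℝ)..Real.pi, relEnergy α ψ j k (pairRotate j k φ (F s))} := by
    refine isClosed_le (continuous_const.mul
      (intervalIntegral.continuous_parametric_intervalIntegral_of_continuous' ?_ _ _))
      (((continuous_pairRel j k).comp hFc).norm.pow 2 |>.mul
      (intervalIntegral.continuous_parametric_intervalIntegral_of_continuous' ?_ _ _))
    · exact (hψ.continuous.comp hFφ).norm.pow 2
    · exact hcont.comp hFφ
  set bad : Set ℝ := insert 0 (Set.range fun q : Fin N × Bool =>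
    (if q.2 then 1 else -1) * (‖pairMid j k x - x q.1‖ / ‖pairRel j k x‖)) with hbad
  have hfin : bad.Finite := (Set.finite_range _).insert 0
  have hsub : badᶜ ⊆ {s : ℝ | C ^ 2 * ∫ φ in (0 : ℝ)..Real.pi,
      ‖ψ (pairRotate j k φ (F s))‖ ^ 2 ≤ ‖pairRel j k (F s)‖ ^ 2
        * ∫ φ in (0 : ℝ)..Real.pi, relEnergy α ψ j k (pairRotate j k φ (F s))} := by
    intro s hs
    have hs0 : s ≠ 0 := fun h => hs (by simp [hbad, h])
    refine hardy_orbit_of_generic hψ hsym hC hjk ?_ (fun l => ?_) hcont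
    · rw [hrel]
      exact smul_ne_zero hs0 hρ
    by_cases hj : l = j
    · exact Or.inr (Or.inl hj)
    by_cases hk : l = k
    · exact Or.inr (Or.inr hk)
    refine Or.inl fun h => hs (Set.mem_insert_of_mem _ ?_)
    rw [hrel, norm_smul] at h
    simp only [hF, pairMid_pairTwist hjk, pairTwist_apply_of_ne hj hk] at h
    have hn : ‖pairRel j k x‖ ≠ 0 := norm_ne_zero_iff.2 hρ
    rw [← div_eq_iff hn, Real.norm_eq_abs] at h
    rcases abs_choice s with h' | h'
    · exact ⟨(l, true), by simp [h, h']⟩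
    · exact ⟨(l, false), by simp [h, h']⟩
  have := hclosed.closure_subset_iff.2 hsub
    ((hfin.countable.dense_compl ℝ).closure_eq ▸ Set.mem_univ 1)
  simpa only [Set.mem_ofPred_eq, hF1] using this

end Hardy

section

variable {α C : ℝ} {ψ : (Fin N → Plane) → ℂ}

lemma measurePreserving_pairRotate {j k : Fin N} (hjk : j ≠ k) (φ : ℝ) :
    MeasurePreserving (pairRotate j k φ) :=
  measurePreserving_pairTwist hjk (Real.cos_sq_add_sin_sq φ)

/-- Averaging over the rotations of a pair preserves integrals against invariant weights. -/
lemma lintegral_mul_lintegral_pairRotate {j k : Fin N} (hjk : j ≠ k)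
    {W F : (Fin N → Plane) → ENNReal} (hW : Measurable W) (hF : Measurable F)
    (hinv : ∀ φ x, W (pairRotate j k φ x) = W x) :
    ∫⁻ x, W x * ∫⁻ φ in Set.Ioc 0 Real.pi, F (pairRotate j k φ x)
      = (∫⁻ x, W x * F x) * ENNReal.ofReal Real.pi := by
  have hrot : Measurable fun p : (Fin N → Plane) × ℝ => pairRotate j k p.2 p.1 :=
    (continuous_pairRotate j k continuous_snd continuous_fst).measurable
  have hm : Measurable fun p : (Fin N → Plane) × ℝ => W p.1 * F (pairRotate j k p.2 p.1) :=
    (hW.comp measurable_fst).mul (hF.comp hrot)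
  calc ∫⁻ x, W x * ∫⁻ φ in Set.Ioc 0 Real.pi, F (pairRotate j k φ x)
      = ∫⁻ x, ∫⁻ φ in Set.Ioc 0 Real.pi, W x * F (pairRotate j k φ x) := by
        refine lintegral_congr fun x => (lintegral_const_mul _ ?_).symm
        have hx : Continuous fun φ => pairRotate j k φ x :=
          continuous_pairRotate j k continuous_id continuous_const
        exact hF.comp hx.measurable
    _ = ∫⁻ φ in Set.Ioc 0 Real.pi, ∫⁻ x, W x * F (pairRotate j k φ x) :=
        lintegral_lintegral_swap hm.aemeasurable
    _ = ∫⁻ _ in Set.Ioc 0 Real.pi, ∫⁻ x, W x * F x := by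
        refine lintegral_congr fun φ => ?_
        have h := (measurePreserving_pairRotate hjk φ).lintegral_comp
          (f := fun x => W x * F x) (hW.mul hF)
        simpa only [hinv] using h
    _ = _ := by simp

lemma lintegral_Ioc_ofReal {f : ℝ → ℝ} (hf : Continuous f) (h0 : ∀ t, 0 ≤ f t) {a b : ℝ}
    (hab : a ≤ b) :
    ∫⁻ t in Set.Ioc a b, ENNReal.ofReal (f t) = ENNReal.ofReal (∫ t in a..b, f t) := by
  rw [intervalIntegral.integral_of_le hab, ofReal_integral_eq_lintegral_ofReal
    ((intervalIntegrable_iff_integrableOn_Ioc_of_le hab).1 (hf.intervalIntegrable a b))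
    (ae_of_all _ h0)]

lemma relEnergy_nonneg (j k : Fin N) (x : Fin N → Plane) : 0 ≤ relEnergy α ψ j k x :=
  Finset.sum_nonneg fun _ _ => by positivity

/-- Weighted magnetic Hardy inequality for a pair of particles at distance at most `2R`. -/
lemma hardy_pair (hψ : ContDiff ℝ (⊤ : ℕ∞) ψ)
    (hsym : ∀ (σ : Equiv.Perm (Fin N)) (x : Fin N → Plane), ψ (x ∘ σ) = ψ x)
    (hsupp : ∀ x ∈ tsupport ψ, ∀ j k : Fin N, j ≠ k → x j ≠ x k)
    (hC : ∀ p : ℕ, p ≤ N - 2 → ∀ q : ℤ, C ^ 2 ≤ ((2 * (p : ℝ) + 1) * α - 2 * q) ^ 2)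
    {j k : Fin N} (hjk : j ≠ k) {W : (Fin N → Plane) → ENNReal} (hW : Measurable W)
    (hinv : ∀ φ x, W (pairRotate j k φ x) = W x) {R : ℝ}
    (hR : ∀ x, W x ≠ 0 → ‖pairRel j k x‖ ≤ R) :
    ENNReal.ofReal (C ^ 2) * ∫⁻ x, W x * ENNReal.ofReal (‖ψ x‖ ^ 2)
      ≤ ENNReal.ofReal (R ^ 2) * ∫⁻ x, W x * ENNReal.ofReal (relEnergy α ψ j k x) := by
  have hcont := continuous_relEnergy (α := α) hψ hsupp j k
  have hf : Continuous fun x => ‖ψ x‖ ^ 2 := hψ.continuous.norm.pow 2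
  have hπ : ENNReal.ofReal Real.pi ≠ 0 := by simp [Real.pi_pos]
  refine (ENNReal.mul_le_mul_iff_left hπ ENNReal.ofReal_ne_top).1 ?_
  rw [mul_assoc, mul_assoc, ← lintegral_mul_lintegral_pairRotate hjk hW
      hf.measurable.ennreal_ofReal hinv, ← lintegral_mul_lintegral_pairRotate hjk hW
      hcont.measurable.ennreal_ofReal hinv, ← lintegral_const_mul' _ _ ENNReal.ofReal_ne_top,
    ← lintegral_const_mul' _ _ ENNReal.ofReal_ne_top]
  refine lintegral_mono fun x => ?_
  have hrot : Continuous fun φ => pairRotate j k φ x :=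
    continuous_pairRotate j k continuous_id continuous_const
  by_cases h0 : W x = 0
  · simp [h0]
  rw [mul_left_comm, mul_left_comm (ENNReal.ofReal (R ^ 2)),
    lintegral_Ioc_ofReal (f := fun φ => ‖ψ (pairRotate j k φ x)‖ ^ 2) (hf.comp hrot)
      (fun _ => by positivity) Real.pi_pos.le,
    lintegral_Ioc_ofReal (f := fun φ => relEnergy α ψ j k (pairRotate j k φ x)) (hcont.comp hrot)
      (fun _ => relEnergy_nonneg _ _ _) Real.pi_pos.le,
    ← ENNReal.ofReal_mul (by positivity), ← ENNReal.ofReal_mul (by positivity)]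
  refine mul_le_mul_right (ENNReal.ofReal_le_ofReal ?_) _
  refine (hardy_orbit hψ hsym hsupp hC hjk x).trans ?_
  have : 0 ≤ ∫ φ in (0 : ℝ)..Real.pi, relEnergy α ψ j k (pairRotate j k φ x) :=
    intervalIntegral.integral_nonneg Real.pi_pos.le fun _ _ => relEnergy_nonneg _ _ _
  have := hR x h0
  gcongr

/-- The kinetic energy density of the particle `j`. -/
noncomputable def kineticDensity (α : ℝ) (ψ : (Fin N → Plane) → ℂ) (j : Fin N)
    (x : Fin N → Plane) : ℝ :=
  ∑ i, ‖anyonD α ψ x j i‖ ^ 2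

lemma kineticDensity_nonneg (j : Fin N) (x : Fin N → Plane) : 0 ≤ kineticDensity α ψ j x :=
  Finset.sum_nonneg fun _ _ => by positivity

lemma continuous_kineticDensity (hψ : ContDiff ℝ (⊤ : ℕ∞) ψ)
    (hsupp : ∀ x ∈ tsupport ψ, ∀ j k : Fin N, j ≠ k → x j ≠ x k) (j : Fin N) :
    Continuous (kineticDensity α ψ j) :=
  continuous_finsetSum _ fun i _ => (continuous_anyonD α hψ hsupp j i).norm.pow 2

/-- Comparison of a wave function at a configuration and at the configuration in which the pair
`j`, `k` is dilated towards `y`. -/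
lemma norm_sq_le_pairDilate (hψ : ContDiff ℝ (⊤ : ℕ∞) ψ)
    (hsupp : ∀ x ∈ tsupport ψ, ∀ j k : Fin N, j ≠ k → x j ≠ x k)
    (j k : Fin N) (y : Plane) {R s : ℝ} (hs : s < 1) {x : Fin N → Plane}
    (hj : ‖x j - y‖ ≤ R) (hk : ‖x k - y‖ ≤ R) :
    ‖ψ x‖ ^ 2 ≤ 4 / 3 * ‖ψ (pairDilate j k y s x)‖ ^ 2 + 8 * (1 - s) * R ^ 2
      * ∫ t in s..1, (kineticDensity α ψ j (pairDilate j k y t x)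
        + kineticDensity α ψ k (pairDilate j k y t x)) := by
  set v : Fin N → Plane := Pi.single j (x j - y) + Pi.single k (x k - y) with hv
  set M : ℝ → Fin N → Plane := fun t => pairDilate j k y t x with hM
  have hM1 : M 1 = x := by simp [hM, pairDilate]
  have hMc : Continuous M := by
    have : Continuous fun t : ℝ => x + (t - 1) • v := by fun_prop
    exact this
  have hMd : ∀ t, HasDerivAt M v t := fun t => by
    have := (((hasDerivAt_id t).sub_const 1).smul_const v).const_add x
    rw [one_smul] at this
    exact this
  have hD : ∀ t, -Complex.I * fderiv ℝ ψ (M t) v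
      + ((∑ i, (x j - y) i * anyonA α (M t) j i + ∑ i, (x k - y) i * anyonA α (M t) k i : ℝ) : ℂ)
        * ψ (M t)
      = ∑ i, ((x j - y) i : ℂ) * anyonD α ψ (M t) j i
        + ∑ i, ((x k - y) i : ℂ) * anyonD α ψ (M t) k i := fun t => by
    rw [sum_mul_anyonD, sum_mul_anyonD, hv, map_add]
    push_cast
    ring
  have hanyon : ∀ l i, Continuous fun t => anyonD α ψ (M t) l i := fun l i =>
    (continuous_anyonD α hψ hsupp l i).comp hMc
  have hDc : Continuous fun t => ∑ i, ((x j - y) i : ℂ) * anyonD α ψ (M t) j i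
        + ∑ i, ((x k - y) i : ℂ) * anyonD α ψ (M t) k i :=
    (continuous_finsetSum _ fun i _ => continuous_const.mul (hanyon j i)).add
      (continuous_finsetSum _ fun i _ => continuous_const.mul (hanyon k i))
  have key := norm_sq_le_add_integral_norm_sq_covariant (u := fun t => ψ (M t))
    (u' := fun t => fderiv ℝ ψ (M t) v)
    (b := fun t => ∑ i, (x j - y) i * anyonA α (M t) j i + ∑ i, (x k - y) i * anyonA α (M t) k i)
    hs (fun t => ((hψ.differentiable (by simp)) _).hasFDerivAt.comp_hasDerivAt t (hMd t))
    (by simpa only [hD] using hDc)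
  simp only [hD, hM1] at key
  have hkc : ∀ l, Continuous fun t => kineticDensity α ψ l (M t) := fun l =>
    (continuous_kineticDensity hψ hsupp l).comp hMc
  have hInt : ∫ t in s..1, ‖∑ i, ((x j - y) i : ℂ) * anyonD α ψ (M t) j i
        + ∑ i, ((x k - y) i : ℂ) * anyonD α ψ (M t) k i‖ ^ 2
      ≤ ∫ t in s..1, 2 * R ^ 2 * (kineticDensity α ψ j (M t) + kineticDensity α ψ k (M t)) := by
    refine intervalIntegral.integral_mono_on hs.le
      (Continuous.intervalIntegrable (hDc.norm.pow 2) _ _) (Continuous.intervalIntegrable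
        (continuous_const.mul ((hkc j).add (hkc k))) _ _) fun t _ => ?_
    refine (norm_sq_add_sum_mul_le _ _ _ _).trans ?_
    refine mul_le_mul_of_nonneg_right ?_
      (add_nonneg (kineticDensity_nonneg j (M t)) (kineticDensity_nonneg k (M t)))
    have h1 := pow_le_pow_left₀ (norm_nonneg _) hj 2
    have h2 := pow_le_pow_left₀ (norm_nonneg _) hk 2
    linarith
  rw [intervalIntegral.integral_const_mul] at hInt
  have h4 : 0 ≤ 4 * (1 - s) := by linarith
  nlinarith [mul_le_mul_of_nonneg_left hInt h4]

end

section

variable {α C : ℝ} {ψ : (Fin N → Plane) → ℂ}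

/-- Integrated form of the comparison along dilations of a pair, with weights. -/
lemma lintegral_norm_sq_le_pairDilate (hψ : ContDiff ℝ (⊤ : ℕ∞) ψ)
    (hsupp : ∀ x ∈ tsupport ψ, ∀ j k : Fin N, j ≠ k → x j ≠ x k)
    {j k : Fin N} (hjk : j ≠ k) (y : Plane) {R s : ℝ} (hs0 : 0 < s) (hs : s < 1)
    {V W : (Fin N → Plane) → ENNReal} (hV : Measurable V) (hW : Measurable W)
    (hR : ∀ x, W x ≠ 0 → ‖x j - y‖ ≤ R ∧ ‖x k - y‖ ≤ R)
    (hWV : ∀ x, W x ≤ V (pairDilate j k y s x))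
    (hWW : ∀ x, ∀ t ∈ Set.Ioc s 1, W x ≤ W (pairDilate j k y t x)) :
    ∫⁻ x, W x * ENNReal.ofReal (‖ψ x‖ ^ 2)
      ≤ ENNReal.ofReal (4 / 3 * (s ^ 4)⁻¹) * (∫⁻ x, V x * ENNReal.ofReal (‖ψ x‖ ^ 2))
        + ENNReal.ofReal (8 * (1 - s) ^ 2 * R ^ 2 * (s ^ 4)⁻¹)
          * ∫⁻ x, W x * ENNReal.ofReal (kineticDensity α ψ j x + kineticDensity α ψ k x) := by
  have hf : Measurable fun x => ENNReal.ofReal (‖ψ x‖ ^ 2) :=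
    (hψ.continuous.norm.pow 2).measurable.ennreal_ofReal
  have hgc : Continuous fun x => kineticDensity α ψ j x + kineticDensity α ψ k x :=
    (continuous_kineticDensity hψ hsupp j).add (continuous_kineticDensity hψ hsupp k)
  set G : (Fin N → Plane) → ENNReal := fun x =>
    ENNReal.ofReal (kineticDensity α ψ j x + kineticDensity α ψ k x) with hG
  have hGm : Measurable G := hgc.measurable.ennreal_ofReal
  have hdil : Measurable fun p : (Fin N → Plane) × ℝ => pairDilate j k y p.2 p.1 :=
    ((continuous_pairDilate j k y).comp continuous_swap).measurable
  have hc : 0 ≤ 8 * (1 - s) * R ^ 2 := by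
    have : 0 ≤ 1 - s := by linarith
    positivity
  have hpt : ∀ x, W x * ENNReal.ofReal (‖ψ x‖ ^ 2)
      ≤ ENNReal.ofReal (4 / 3) * (V (pairDilate j k y s x)
          * ENNReal.ofReal (‖ψ (pairDilate j k y s x)‖ ^ 2))
        + ENNReal.ofReal (8 * (1 - s) * R ^ 2) * ∫⁻ t in Set.Ioc s 1,
          W (pairDilate j k y t x) * G (pairDilate j k y t x) := fun x => by
    by_cases h0 : W x = 0
    · simp [h0]
    have hx : Continuous fun t => pairDilate j k y t x := by
      have h := (continuous_pairDilate j k y).comp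
        (continuous_id.prodMk continuous_const : Continuous fun t : ℝ => (t, x))
      exact h
    have h1 := norm_sq_le_pairDilate (α := α) hψ hsupp j k y hs (hR x h0).1 (hR x h0).2
    have hI : 0 ≤ ∫ t in s..1, (kineticDensity α ψ j (pairDilate j k y t x)
        + kineticDensity α ψ k (pairDilate j k y t x)) :=
      intervalIntegral.integral_nonneg hs.le fun t _ =>
        add_nonneg (kineticDensity_nonneg _ _) (kineticDensity_nonneg _ _)
    have h2 := ENNReal.ofReal_le_ofReal h1
    rw [ENNReal.ofReal_add (by positivity) (mul_nonneg hc hI), ENNReal.ofReal_mul (by norm_num),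
      ENNReal.ofReal_mul hc, ← lintegral_Ioc_ofReal
        (f := fun t => kineticDensity α ψ j (pairDilate j k y t x)
        + kineticDensity α ψ k (pairDilate j k y t x)) (hgc.comp hx)
        (fun t => add_nonneg (kineticDensity_nonneg _ _) (kineticDensity_nonneg _ _)) hs.le] at h2
    refine (mul_le_mul_right h2 (W x)).trans ?_
    rw [mul_add, mul_left_comm, mul_left_comm (W x) (ENNReal.ofReal (8 * (1 - s) * R ^ 2))]
    gcongr
    · exact hWV x
    refine (lintegral_const_mul (W x) (f := fun t => G (pairDilate j k y t x))
      (hGm.comp hx.measurable)).ge.trans ?_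
    exact setLIntegral_mono' measurableSet_Ioc fun t ht => mul_le_mul_left (hWW x t ht) _
  refine (lintegral_mono hpt).trans ?_
  have hm1 : Measurable fun x => V x * ENNReal.ofReal (‖ψ x‖ ^ 2) := hV.mul hf
  have hm2 : Measurable fun x => W x * G x := hW.mul hGm
  have hm3 : Measurable fun x => V (pairDilate j k y s x)
      * ENNReal.ofReal (‖ψ (pairDilate j k y s x)‖ ^ 2) :=
    hm1.comp (hdil.comp measurable_prodMk_right)
  have hm4 : Measurable fun p : (Fin N → Plane) × ℝ =>
      W (pairDilate j k y p.2 p.1) * G (pairDilate j k y p.2 p.1) := hm2.comp hdil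
  rw [lintegral_add_left (hm3.const_mul _), lintegral_const_mul _ hm3,
    lintegral_const_mul' _ _ ENNReal.ofReal_ne_top,
    lintegral_comp_pairDilate hjk y hs0 hm1, ← mul_assoc, ← ENNReal.ofReal_mul (by norm_num)]
  refine add_le_add le_rfl ?_
  rw [lintegral_lintegral_swap hm4.aemeasurable]
  have hsq : 8 * (1 - s) ^ 2 * R ^ 2 * (s ^ 4)⁻¹
      = 8 * (1 - s) * R ^ 2 * ((s ^ 4)⁻¹ * (1 - s)) := by ring
  rw [hsq, ENNReal.ofReal_mul hc, mul_assoc (ENNReal.ofReal _)]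
  refine mul_le_mul_right ?_ _
  calc ∫⁻ t in Set.Ioc s 1, ∫⁻ x, W (pairDilate j k y t x) * G (pairDilate j k y t x)
      ≤ ∫⁻ _ in Set.Ioc s 1, ENNReal.ofReal ((s ^ 4)⁻¹) * ∫⁻ x, W x * G x := by
        refine setLIntegral_mono' measurableSet_Ioc fun t ht => ?_
        have ht0 : 0 < t := hs0.trans ht.1
        rw [lintegral_comp_pairDilate hjk y ht0 hm2]
        have := ht.1.le
        gcongr
    _ = _ := by
        rw [lintegral_const, Measure.restrict_apply MeasurableSet.univ, Set.univ_inter,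
          Real.volume_Ioc, ENNReal.ofReal_mul (by positivity)]
        ring

end

/-- The indicator function of the open disk of radius `R` around `y`. -/
noncomputable def diskInd (y : Plane) (R : ℝ) : Plane → ENNReal := (Metric.ball y R).indicator 1

lemma measurable_diskInd (y : Plane) (R : ℝ) : Measurable (diskInd y R) :=
  measurable_one.indicator Metric.isOpen_ball.measurableSet

lemma diskInd_of_lt {y v : Plane} {R : ℝ} (h : ‖v - y‖ < R) : diskInd y R v = 1 :=
  Set.indicator_of_mem (by rwa [mem_ball_iff_norm]) _

lemma diskInd_of_le {y v : Plane} {R : ℝ} (h : R ≤ ‖v - y‖) : diskInd y R v = 0 :=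
  Set.indicator_of_notMem (by rwa [mem_ball_iff_norm, not_lt]) _

/-- The inverse of the number of particles in a disk, given that `j` and `k` lie in it. -/
noncomputable def othersWeight (y : Plane) (R : ℝ) (j k : Fin N) (x : Fin N → Plane) : ENNReal :=
  (2 + ∑ l ∈ (Finset.univ.erase j).erase k, diskInd y R (x l))⁻¹

lemma measurable_othersWeight (y : Plane) (R : ℝ) (j k : Fin N) :
    Measurable (othersWeight y R j k) :=
  (measurable_const.add (Finset.measurable_fun_sum _ fun l _ =>
    (measurable_diskInd y R).comp (measurable_pi_apply l))).inv

lemma othersWeight_congr (y : Plane) (R : ℝ) {j k : Fin N} {x z : Fin N → Plane}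
    (h : ∀ l, l ≠ j → l ≠ k → x l = z l) : othersWeight y R j k x = othersWeight y R j k z := by
  unfold othersWeight
  congr 2
  refine Finset.sum_congr rfl fun l hl => ?_
  simp only [Finset.mem_erase] at hl
  rw [h l hl.2.1 hl.1]

/-- The weight of a pair in a disk. -/
noncomputable def pairWeight (y : Plane) (R : ℝ) (j k : Fin N) (x : Fin N → Plane) : ENNReal :=
  diskInd y R (x j) * diskInd y R (x k) * othersWeight y R j k x

lemma measurable_pairWeight (y : Plane) (R : ℝ) (j k : Fin N) :
    Measurable (pairWeight y R j k) :=
  (((measurable_diskInd y R).comp (measurable_pi_apply j)).mul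
    ((measurable_diskInd y R).comp (measurable_pi_apply k))).mul (measurable_othersWeight y R j k)

lemma norm_lt_of_pairWeight_ne_zero {y : Plane} {R : ℝ} {j k : Fin N} {x : Fin N → Plane}
    (h : pairWeight y R j k x ≠ 0) : ‖x j - y‖ < R ∧ ‖x k - y‖ < R := by
  constructor <;> refine not_le.1 fun h' => h ?_ <;> simp [pairWeight, diskInd_of_le h']

lemma pairWeight_of_lt {y : Plane} {R : ℝ} {j k : Fin N} {x : Fin N → Plane}
    (hj : ‖x j - y‖ < R) (hk : ‖x k - y‖ < R) :
    pairWeight y R j k x = othersWeight y R j k x := by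
  simp [pairWeight, diskInd_of_lt hj, diskInd_of_lt hk]

/-- The weight of a pair whose whole rotation orbit lies in a disk. -/
noncomputable def orbitWeight (y : Plane) (R : ℝ) (j k : Fin N) (x : Fin N → Plane) : ENNReal :=
  {z : Fin N → Plane | ‖pairMid j k z - y‖ + ‖pairRel j k z‖ < R}.indicator
    (othersWeight y R j k) x

lemma measurable_orbitWeight (y : Plane) (R : ℝ) (j k : Fin N) :
    Measurable (orbitWeight y R j k) :=
  (measurable_othersWeight y R j k).indicator
    (isOpen_lt (by fun_prop) continuous_const).measurableSet

lemma orbitWeight_of_lt {y : Plane} {R : ℝ} {j k : Fin N} {x : Fin N → Plane}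
    (h : ‖pairMid j k x - y‖ + ‖pairRel j k x‖ < R) :
    orbitWeight y R j k x = othersWeight y R j k x :=
  Set.indicator_of_mem (s := {z : Fin N → Plane | ‖pairMid j k z - y‖ + ‖pairRel j k z‖ < R}) h _

lemma lt_of_orbitWeight_ne_zero {y : Plane} {R : ℝ} {j k : Fin N} {x : Fin N → Plane}
    (h : orbitWeight y R j k x ≠ 0) : ‖pairMid j k x - y‖ + ‖pairRel j k x‖ < R :=
  Set.mem_of_indicator_ne_zero
    (s := {z : Fin N → Plane | ‖pairMid j k z - y‖ + ‖pairRel j k z‖ < R}) h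

lemma orbitWeight_pairRotate (y : Plane) (R : ℝ) {j k : Fin N} (hjk : j ≠ k) (φ : ℝ)
    (x : Fin N → Plane) : orbitWeight y R j k (pairRotate j k φ x) = orbitWeight y R j k x := by
  have h1 : pairMid j k (pairRotate j k φ x) = pairMid j k x := pairMid_pairTwist hjk _ _ x
  have h2 : ‖pairRel j k (pairRotate j k φ x)‖ = ‖pairRel j k x‖ :=
    norm_pairRel_pairTwist hjk (Real.cos_sq_add_sin_sq φ) x
  have h3 : othersWeight y R j k (pairRotate j k φ x) = othersWeight y R j k x :=
    othersWeight_congr y R fun l hj hk => pairRotate_apply_of_ne hj hk φ x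
  simp only [orbitWeight, Set.indicator_apply, Set.mem_ofPred_eq, h1, h2, h3]

lemma orbitWeight_le_pairWeight (y : Plane) (R : ℝ) (j k : Fin N) (x : Fin N → Plane) :
    orbitWeight y R j k x ≤ pairWeight y R j k x := by
  by_cases h : orbitWeight y R j k x = 0
  · simp [h]
  have h' := lt_of_orbitWeight_ne_zero h
  rw [orbitWeight_of_lt h', pairWeight_of_lt]
  · rw [← pairMid_add_pairRel j k x, add_sub_right_comm]
    exact (norm_add_le _ _).trans_lt h'
  · rw [← pairMid_sub_pairRel j k x, sub_right_comm]
    exact (norm_sub_le _ _).trans_lt h'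

lemma othersWeight_pairDilate (y : Plane) (R : ℝ) (j k : Fin N) (t : ℝ) (x : Fin N → Plane) :
    othersWeight y R j k (pairDilate j k y t x) = othersWeight y R j k x :=
  othersWeight_congr y R fun _ hj hk => pairDilate_apply_of_ne hj hk y t x

lemma pairWeight_le_pairDilate (y : Plane) (R : ℝ) {j k : Fin N} (hjk : j ≠ k) {t : ℝ}
    (ht0 : 0 ≤ t) (ht1 : t ≤ 1) (x : Fin N → Plane) :
    pairWeight y R j k x ≤ pairWeight y R j k (pairDilate j k y t x) := by
  by_cases h : pairWeight y R j k x = 0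
  · simp [h]
  obtain ⟨hj, hk⟩ := norm_lt_of_pairWeight_ne_zero h
  rw [pairWeight_of_lt hj hk, pairWeight_of_lt, othersWeight_pairDilate]
  · rw [pairDilate_apply_left hjk, add_sub_cancel_left, norm_smul, Real.norm_of_nonneg ht0]
    exact (mul_le_of_le_one_left (norm_nonneg _) ht1).trans_lt hj
  · rw [pairDilate_apply_right hjk, add_sub_cancel_left, norm_smul, Real.norm_of_nonneg ht0]
    exact (mul_le_of_le_one_left (norm_nonneg _) ht1).trans_lt hk

lemma pairWeight_le_orbitWeight_pairDilate (y : Plane) (R : ℝ) {j k : Fin N} (hjk : j ≠ k)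
    {t : ℝ} (ht0 : 0 ≤ t) (ht : 2 * t ^ 2 ≤ 1) (x : Fin N → Plane) :
    pairWeight y R j k x ≤ orbitWeight y R j k (pairDilate j k y t x) := by
  by_cases h : pairWeight y R j k x = 0
  · simp [h]
  obtain ⟨hj, hk⟩ := norm_lt_of_pairWeight_ne_zero h
  rw [pairWeight_of_lt hj hk, orbitWeight_of_lt, othersWeight_pairDilate]
  set z := pairDilate j k y t x with hz
  have h1 := norm_sq_pairMid_add_norm_sq_pairRel j k z y
  have hzj : ‖z j - y‖ = t * ‖x j - y‖ := by
    rw [hz, pairDilate_apply_left hjk, add_sub_cancel_left, norm_smul, Real.norm_of_nonneg ht0]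
  have hzk : ‖z k - y‖ = t * ‖x k - y‖ := by
    rw [hz, pairDilate_apply_right hjk, add_sub_cancel_left, norm_smul, Real.norm_of_nonneg ht0]
  rw [hzj, hzk] at h1
  have hR : 0 < R := (norm_nonneg _).trans_lt hj
  have hj2 : ‖x j - y‖ ^ 2 < R ^ 2 := pow_lt_pow_left₀ hj (norm_nonneg _) two_ne_zero
  have hk2 : ‖x k - y‖ ^ 2 < R ^ 2 := pow_lt_pow_left₀ hk (norm_nonneg _) two_ne_zero
  refine lt_of_pow_lt_pow_left₀ 2 hR.le ?_
  nlinarith [sq_nonneg (‖pairMid j k z - y‖ - ‖pairRel j k z‖), sq_nonneg t, sq_nonneg ‖x j - y‖]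

section

variable {α C : ℝ} {ψ : (Fin N → Plane) → ℂ}

/-- Local exclusion inequality for a pair of particles in a disk of radius `R`. -/
lemma pair_exclusion (hψ : ContDiff ℝ (⊤ : ℕ∞) ψ)
    (hsym : ∀ (σ : Equiv.Perm (Fin N)) (x : Fin N → Plane), ψ (x ∘ σ) = ψ x)
    (hsupp : ∀ x ∈ tsupport ψ, ∀ j k : Fin N, j ≠ k → x j ≠ x k)
    (hC : ∀ p : ℕ, p ≤ N - 2 → ∀ q : ℤ, C ^ 2 ≤ ((2 * (p : ℝ) + 1) * α - 2 * q) ^ 2)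
    (hC1 : C ^ 2 ≤ 1) {j k : Fin N} (hjk : j ≠ k) (y : Plane) (R : ℝ) :
    ENNReal.ofReal (C ^ 2) * ∫⁻ x, pairWeight y R j k x * ENNReal.ofReal (‖ψ x‖ ^ 2)
      ≤ ENNReal.ofReal (R ^ 2) * ∫⁻ x, pairWeight y R j k x * ENNReal.ofReal
        (5.56 * relEnergy α ψ j k x + 3 * (kineticDensity α ψ j x + kineticDensity α ψ k x)) := by
  have hP := lintegral_norm_sq_le_pairDilate (α := α) hψ hsupp hjk y (R := R) (s := 7 / 10)
    (by norm_num) (by norm_num) (measurable_orbitWeight y R j k) (measurable_pairWeight y R j k)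
    (fun x hx => (norm_lt_of_pairWeight_ne_zero hx).imp le_of_lt le_of_lt)
    (pairWeight_le_orbitWeight_pairDilate y R hjk (by norm_num) (by norm_num))
    (fun x t ht => pairWeight_le_pairDilate y R hjk (by linarith [ht.1]) ht.2 x)
  have hH := hardy_pair hψ hsym hsupp hC hjk (measurable_orbitWeight y R j k)
    (orbitWeight_pairRotate y R hjk) (R := R)
    (fun x hx => by linarith [lt_of_orbitWeight_ne_zero hx, norm_nonneg (pairMid j k x - y)])
  have hVW : ∫⁻ x, orbitWeight y R j k x * ENNReal.ofReal (relEnergy α ψ j k x)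
      ≤ ∫⁻ x, pairWeight y R j k x * ENNReal.ofReal (relEnergy α ψ j k x) :=
    lintegral_mono fun x => mul_le_mul_left (orbitWeight_le_pairWeight y R j k x) _
  have hsplit : ∫⁻ x, pairWeight y R j k x * ENNReal.ofReal
        (5.56 * relEnergy α ψ j k x + 3 * (kineticDensity α ψ j x + kineticDensity α ψ k x))
      = ENNReal.ofReal 5.56 * (∫⁻ x, pairWeight y R j k x * ENNReal.ofReal (relEnergy α ψ j k x))
        + ENNReal.ofReal 3 * ∫⁻ x, pairWeight y R j k x
          * ENNReal.ofReal (kineticDensity α ψ j x + kineticDensity α ψ k x) := by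
    have hm : Measurable fun x => pairWeight y R j k x * ENNReal.ofReal (relEnergy α ψ j k x) :=
      (measurable_pairWeight y R j k).mul
        (continuous_relEnergy hψ hsupp j k).measurable.ennreal_ofReal
    rw [← lintegral_const_mul' _ _ ENNReal.ofReal_ne_top,
      ← lintegral_const_mul' _ _ ENNReal.ofReal_ne_top, ← lintegral_add_left (hm.const_mul _)]
    refine lintegral_congr fun x => ?_
    have h1 : 0 ≤ relEnergy α ψ j k x := relEnergy_nonneg j k x
    have h2 : 0 ≤ kineticDensity α ψ j x + kineticDensity α ψ k x :=
      add_nonneg (kineticDensity_nonneg j x) (kineticDensity_nonneg k x)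
    rw [ENNReal.ofReal_add (by positivity) (by positivity), ENNReal.ofReal_mul (by norm_num),
      ENNReal.ofReal_mul (by norm_num)]
    ring
  rw [hsplit]
  set A := ∫⁻ x, orbitWeight y R j k x * ENNReal.ofReal (‖ψ x‖ ^ 2)
  set H := ∫⁻ x, pairWeight y R j k x * ENNReal.ofReal (relEnergy α ψ j k x)
  set G := ∫⁻ x, pairWeight y R j k x
    * ENNReal.ofReal (kineticDensity α ψ j x + kineticDensity α ψ k x)
  have hH' : ENNReal.ofReal (C ^ 2) * A ≤ ENNReal.ofReal (R ^ 2) * H :=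
    hH.trans (mul_le_mul_right hVW _)
  have hc1 : ENNReal.ofReal (4 / 3 * ((7 / 10 : ℝ) ^ 4)⁻¹) ≤ ENNReal.ofReal 5.56 :=
    ENNReal.ofReal_le_ofReal (by norm_num)
  have hc2 : ENNReal.ofReal (8 * (1 - 7 / 10 : ℝ) ^ 2 * R ^ 2 * ((7 / 10 : ℝ) ^ 4)⁻¹)
      ≤ ENNReal.ofReal (R ^ 2) * ENNReal.ofReal 3 := by
    rw [← ENNReal.ofReal_mul (by positivity)]
    exact ENNReal.ofReal_le_ofReal (by nlinarith [sq_nonneg R])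
  have hc3 : ENNReal.ofReal (C ^ 2) ≤ 1 := by simpa using ENNReal.ofReal_le_ofReal hC1
  calc ENNReal.ofReal (C ^ 2) * ∫⁻ x, pairWeight y R j k x * ENNReal.ofReal (‖ψ x‖ ^ 2)
      ≤ ENNReal.ofReal (C ^ 2) * (ENNReal.ofReal 5.56 * A
        + ENNReal.ofReal (R ^ 2) * ENNReal.ofReal 3 * G) := by
        refine mul_le_mul_right (hP.trans (add_le_add ?_ ?_)) _
        · exact mul_le_mul_left hc1 _
        · exact mul_le_mul_left hc2 _
    _ = ENNReal.ofReal 5.56 * (ENNReal.ofReal (C ^ 2) * A)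
        + ENNReal.ofReal (C ^ 2) * (ENNReal.ofReal (R ^ 2) * ENNReal.ofReal 3 * G) := by ring
    _ ≤ ENNReal.ofReal 5.56 * (ENNReal.ofReal (R ^ 2) * H)
        + 1 * (ENNReal.ofReal (R ^ 2) * ENNReal.ofReal 3 * G) := by gcongr
    _ = _ := by ring

end

lemma sum_sum_norm_sub_sq_le {ι : Type*} (A : Finset ι) (u : ι → ℂ) :
    ∑ j ∈ A, ∑ k ∈ A, ‖u j - u k‖ ^ 2 ≤ 2 * A.card * ∑ j ∈ A, ‖u j‖ ^ 2 := by
  have h : ∀ j k, ‖u j - u k‖ ^ 2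
      = ‖u j‖ ^ 2 + ‖u k‖ ^ 2 - 2 * ((u j).re * (u k).re) - 2 * ((u j).im * (u k).im) := by
    intro j k
    simp only [Complex.sq_norm, Complex.normSq_apply, Complex.sub_re, Complex.sub_im]
    ring
  simp only [h, Finset.sum_sub_distrib, Finset.sum_add_distrib, ← Finset.mul_sum,
    ← Finset.sum_mul, Finset.sum_const, nsmul_eq_mul]
  nlinarith [mul_self_nonneg (∑ j ∈ A, (u j).re), mul_self_nonneg (∑ j ∈ A, (u j).im)]

section

open Classical in
/-- The set of particles in a disk. -/
noncomputable def inDisk (y : Plane) (R : ℝ) (x : Fin N → Plane) : Finset (Fin N) :=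
  Finset.univ.filter fun l => ‖x l - y‖ < R

lemma mem_inDisk {y : Plane} {R : ℝ} {x : Fin N → Plane} {l : Fin N} :
    l ∈ inDisk y R x ↔ ‖x l - y‖ < R := by
  simp [inDisk]

lemma diskInd_eq_ite (y : Plane) (R : ℝ) (x : Fin N → Plane) (l : Fin N) :
    diskInd y R (x l) = if l ∈ inDisk y R x then 1 else 0 := by
  split_ifs with h
  · exact diskInd_of_lt (mem_inDisk.1 h)
  · exact diskInd_of_le (not_lt.1 fun h' => h (mem_inDisk.2 h'))

lemma sum_diskInd_mul (y : Plane) (R : ℝ) (x : Fin N → Plane) (a : Fin N → ENNReal) :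
    ∑ l, diskInd y R (x l) * a l = ∑ l ∈ inDisk y R x, a l := by
  simp [diskInd_eq_ite, ite_mul]

lemma sum_diskInd (y : Plane) (R : ℝ) (x : Fin N → Plane) :
    ∑ l, diskInd y R (x l) = (inDisk y R x).card := by
  simp [diskInd_eq_ite]

lemma pairWeight_eq_ite (y : Plane) (R : ℝ) {j k : Fin N} (hjk : j ≠ k) (x : Fin N → Plane) :
    pairWeight y R j k x
      = if j ∈ inDisk y R x ∧ k ∈ inDisk y R x then ((inDisk y R x).card : ENNReal)⁻¹ else 0 := by
  split_ifs with h
  · have hj := mem_inDisk.1 h.1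
    have hk := mem_inDisk.1 h.2
    rw [pairWeight_of_lt hj hk, othersWeight, ← sum_diskInd,
      ← Finset.add_sum_erase _ _ (Finset.mem_univ j),
      ← Finset.add_sum_erase _ _ (Finset.mem_erase.2 ⟨hjk.symm, Finset.mem_univ k⟩),
      diskInd_of_lt hj, diskInd_of_lt hk, ← add_assoc, one_add_one_eq_two]
  · by_contra h0
    have := norm_lt_of_pairWeight_ne_zero h0
    exact h ⟨mem_inDisk.2 this.1, mem_inDisk.2 this.2⟩

lemma sum_diskInd_le (y : Plane) (R : ℝ) (x : Fin N → Plane) :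
    ∑ l, diskInd y R (x l)
      ≤ 1 + ∑ j, ∑ k ∈ Finset.univ.erase j, pairWeight y R j k x := by
  set A := inDisk y R x with hA
  have hsum : ∑ j, ∑ k ∈ Finset.univ.erase j, pairWeight y R j k x
      = A.card * ((A.card - 1 : ℕ) * (A.card : ENNReal)⁻¹) := by
    have h1 : ∀ j, ∑ k ∈ Finset.univ.erase j, pairWeight y R j k x
        = if j ∈ A then (A.card - 1 : ℕ) * (A.card : ENNReal)⁻¹ else 0 := fun j => by
      split_ifs with hj
      · have : ∑ k ∈ Finset.univ.erase j, pairWeight y R j k x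
            = ∑ k ∈ Finset.univ.erase j, if k ∈ A.erase j then (A.card : ENNReal)⁻¹ else 0 := by
          refine Finset.sum_congr rfl fun k hk => ?_
          have hkj := Finset.ne_of_mem_erase hk
          rw [pairWeight_eq_ite y R hkj.symm]
          simp [hj, hkj, ← hA]
        rw [this, Finset.sum_ite_mem, Finset.inter_eq_right.2
          (Finset.erase_subset_erase _ (Finset.subset_univ _)), Finset.sum_const,
          Finset.card_erase_of_mem hj, nsmul_eq_mul]
      · refine Finset.sum_eq_zero fun k hk => ?_
        rw [pairWeight_eq_ite y R (Finset.ne_of_mem_erase hk).symm, if_neg fun h => hj h.1]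
    simp only [h1, Finset.sum_ite_mem, Finset.univ_inter, Finset.sum_const, nsmul_eq_mul]
  rw [hsum, sum_diskInd, ← hA]
  rcases Nat.eq_zero_or_pos A.card with h | h
  · simp [h]
  · rw [mul_left_comm, ENNReal.mul_inv_cancel (by exact_mod_cast h.ne') (ENNReal.natCast_ne_top _),
      mul_one]
    exact_mod_cast (by omega : A.card ≤ 1 + (A.card - 1))

variable {α C : ℝ} {ψ : (Fin N → Plane) → ℂ}

lemma sum_sum_pair_energy_le (A : Finset (Fin N)) (x : Fin N → Plane) :
    ∑ j ∈ A, ∑ k ∈ A, (5.56 * relEnergy α ψ j k x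
        + 3 * (kineticDensity α ψ j x + kineticDensity α ψ k x))
      ≤ A.card * (17.12 * ∑ j ∈ A, kineticDensity α ψ j x) := by
  have h1 : ∑ j ∈ A, ∑ k ∈ A, relEnergy α ψ j k x
      ≤ 2 * A.card * ∑ j ∈ A, kineticDensity α ψ j x := by
    simp only [relEnergy, kineticDensity, Fin.sum_univ_two, Finset.sum_add_distrib, mul_add]
    exact add_le_add (sum_sum_norm_sub_sq_le A _) (sum_sum_norm_sub_sq_le A _)
  have h2 : ∑ j ∈ A, ∑ k ∈ A, (kineticDensity α ψ j x + kineticDensity α ψ k x)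
      = 2 * A.card * ∑ j ∈ A, kineticDensity α ψ j x := by
    simp only [Finset.sum_add_distrib, Finset.sum_const, nsmul_eq_mul, ← Finset.mul_sum]
    ring
  calc _ = 5.56 * ∑ j ∈ A, ∑ k ∈ A, relEnergy α ψ j k x
        + 3 * ∑ j ∈ A, ∑ k ∈ A, (kineticDensity α ψ j x + kineticDensity α ψ k x) := by
        simp only [Finset.mul_sum, ← Finset.sum_add_distrib]
    _ ≤ _ := by rw [h2]; linarith

lemma sum_pairWeight_mul_le (y : Plane) (R : ℝ) (x : Fin N → Plane) :
    ∑ j, ∑ k ∈ Finset.univ.erase j, pairWeight y R j k x * ENNReal.ofReal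
        (5.56 * relEnergy α ψ j k x + 3 * (kineticDensity α ψ j x + kineticDensity α ψ k x))
      ≤ ENNReal.ofReal 17.12
        * ∑ j, diskInd y R (x j) * ENNReal.ofReal (kineticDensity α ψ j x) := by
  set A := inDisk y R x with hA
  set a : Fin N → Fin N → ℝ := fun j k => 5.56 * relEnergy α ψ j k x
    + 3 * (kineticDensity α ψ j x + kineticDensity α ψ k x) with ha
  have ha0 : ∀ j k, 0 ≤ a j k := fun j k => by
    have h1 : 0 ≤ relEnergy α ψ j k x := relEnergy_nonneg j k x
    have h2 : 0 ≤ kineticDensity α ψ j x := kineticDensity_nonneg j x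
    have h3 : 0 ≤ kineticDensity α ψ k x := kineticDensity_nonneg k x
    simp only [ha]
    positivity
  calc ∑ j, ∑ k ∈ Finset.univ.erase j, pairWeight y R j k x * ENNReal.ofReal (a j k)
      ≤ ∑ j, if j ∈ A then ∑ k, if k ∈ A then
          (A.card : ENNReal)⁻¹ * ENNReal.ofReal (a j k) else 0 else 0 := by
        refine Finset.sum_le_sum fun j _ => ?_
        split_ifs with hj
        · refine (Finset.sum_le_sum fun k hk => ?_).trans
            (Finset.sum_le_sum_of_subset (Finset.erase_subset j _))
          rw [pairWeight_eq_ite y R (Finset.ne_of_mem_erase hk).symm, ← hA]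
          by_cases hk : k ∈ A <;> simp [hj, hk]
        · refine (Finset.sum_eq_zero fun k hk => ?_).le
          rw [pairWeight_eq_ite y R (Finset.ne_of_mem_erase hk).symm, if_neg fun h => hj h.1,
            zero_mul]
    _ = (A.card : ENNReal)⁻¹ * ENNReal.ofReal (∑ j ∈ A, ∑ k ∈ A, a j k) := by
        rw [ENNReal.ofReal_sum_of_nonneg fun j _ => Finset.sum_nonneg fun k _ => ha0 j k]
        simp only [ENNReal.ofReal_sum_of_nonneg fun k _ => ha0 _ k, Finset.sum_ite_mem,
          Finset.univ_inter, Finset.mul_sum]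
    _ ≤ (A.card : ENNReal)⁻¹
        * (A.card * ENNReal.ofReal (17.12 * ∑ j ∈ A, kineticDensity α ψ j x)) := by
        rw [← ENNReal.ofReal_natCast, ← ENNReal.ofReal_mul (Nat.cast_nonneg _)]
        exact mul_le_mul_right (ENNReal.ofReal_le_ofReal (sum_sum_pair_energy_le A x)) _
    _ ≤ ENNReal.ofReal (17.12 * ∑ j ∈ A, kineticDensity α ψ j x) := by
        rw [← mul_assoc]
        exact mul_le_of_le_one_left zero_le (ENNReal.inv_mul_le_one _)
    _ = _ := by
        rw [sum_diskInd_mul, ENNReal.ofReal_mul (by norm_num),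
          ENNReal.ofReal_sum_of_nonneg fun j _ => kineticDensity_nonneg j x]

lemma sum_sum_erase_lintegral {G : Fin N → Fin N → (Fin N → Plane) → ENNReal}
    (hG : ∀ j k, Measurable (G j k)) :
    ∑ j, ∑ k ∈ Finset.univ.erase j, ∫⁻ x, G j k x
      = ∫⁻ x, ∑ j, ∑ k ∈ Finset.univ.erase j, G j k x := by
  rw [lintegral_finsetSum _ fun j _ => Finset.measurable_fun_sum _ fun k _ => hG j k]
  exact Finset.sum_congr rfl fun j _ => (lintegral_finsetSum _ fun k _ => hG j k).symm

/-- Local exclusion inequality for all the particles in a disk of radius `R`. -/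
lemma disk_exclusion (hψ : ContDiff ℝ (⊤ : ℕ∞) ψ)
    (hsym : ∀ (σ : Equiv.Perm (Fin N)) (x : Fin N → Plane), ψ (x ∘ σ) = ψ x)
    (hsupp : ∀ x ∈ tsupport ψ, ∀ j k : Fin N, j ≠ k → x j ≠ x k)
    (hC : ∀ p : ℕ, p ≤ N - 2 → ∀ q : ℤ, C ^ 2 ≤ ((2 * (p : ℝ) + 1) * α - 2 * q) ^ 2)
    (hC1 : C ^ 2 ≤ 1) (y : Plane) (R : ℝ) :
    ENNReal.ofReal (C ^ 2) * ∑ j, ∫⁻ x, diskInd y R (x j) * ENNReal.ofReal (‖ψ x‖ ^ 2)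
      ≤ ENNReal.ofReal (C ^ 2) * (∫⁻ x, ENNReal.ofReal (‖ψ x‖ ^ 2))
        + ENNReal.ofReal (17.12 * R ^ 2)
          * ∑ j, ∫⁻ x, diskInd y R (x j) * ENNReal.ofReal (kineticDensity α ψ j x) := by
  have hf : Measurable fun x => ENNReal.ofReal (‖ψ x‖ ^ 2) :=
    (hψ.continuous.norm.pow 2).measurable.ennreal_ofReal
  have hind : ∀ j : Fin N, Measurable fun x : Fin N → Plane => diskInd y R (x j) := fun j =>
    (measurable_diskInd y R).comp (measurable_pi_apply j)
  have hk : ∀ j : Fin N, Measurable fun x => ENNReal.ofReal (kineticDensity α ψ j x) := fun j =>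
    (continuous_kineticDensity hψ hsupp j).measurable.ennreal_ofReal
  have ha : ∀ j k : Fin N, Measurable fun x => ENNReal.ofReal (5.56 * relEnergy α ψ j k x
      + 3 * (kineticDensity α ψ j x + kineticDensity α ψ k x)) := fun j k =>
    ((continuous_const.mul (continuous_relEnergy hψ hsupp j k)).add (continuous_const.mul
      ((continuous_kineticDensity hψ hsupp j).add
        (continuous_kineticDensity hψ hsupp k)))).measurable.ennreal_ofReal
  have hw := fun j k : Fin N => measurable_pairWeight y R j k
  have hleft : ∑ j, ∫⁻ x, diskInd y R (x j) * ENNReal.ofReal (‖ψ x‖ ^ 2)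
      ≤ (∫⁻ x, ENNReal.ofReal (‖ψ x‖ ^ 2)) + ∑ j, ∑ k ∈ Finset.univ.erase j,
        ∫⁻ x, pairWeight y R j k x * ENNReal.ofReal (‖ψ x‖ ^ 2) := by
    rw [← lintegral_finsetSum _ (f := fun j x => diskInd y R (x j) * ENNReal.ofReal (‖ψ x‖ ^ 2))
      fun j _ => (hind j).mul hf, sum_sum_erase_lintegral
      (G := fun j k x => pairWeight y R j k x * ENNReal.ofReal (‖ψ x‖ ^ 2))
      fun j k => (hw j k).mul hf, ← lintegral_add_left hf]
    refine lintegral_mono fun x => ?_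
    simp only [← Finset.sum_mul]
    refine (mul_le_mul_left (sum_diskInd_le y R x) _).trans_eq ?_
    rw [add_mul, one_mul]
  have hright : ∑ j, ∑ k ∈ Finset.univ.erase j, ∫⁻ x, pairWeight y R j k x * ENNReal.ofReal
        (5.56 * relEnergy α ψ j k x + 3 * (kineticDensity α ψ j x + kineticDensity α ψ k x))
      ≤ ENNReal.ofReal 17.12
        * ∑ j, ∫⁻ x, diskInd y R (x j) * ENNReal.ofReal (kineticDensity α ψ j x) := by
    rw [← lintegral_finsetSum _
      (f := fun j x => diskInd y R (x j) * ENNReal.ofReal (kineticDensity α ψ j x))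
      fun j _ => (hind j).mul (hk j), sum_sum_erase_lintegral
      (G := fun j k x => pairWeight y R j k x * ENNReal.ofReal (5.56 * relEnergy α ψ j k x
        + 3 * (kineticDensity α ψ j x + kineticDensity α ψ k x)))
      fun j k => (hw j k).mul (ha j k),
      ← lintegral_const_mul' _ _ ENNReal.ofReal_ne_top]
    exact lintegral_mono fun x => sum_pairWeight_mul_le y R x
  refine (mul_le_mul_right hleft _).trans ?_
  rw [mul_add, mul_comm (17.12 : ℝ), ENNReal.ofReal_mul (by positivity), mul_assoc]
  refine add_le_add le_rfl (le_trans ?_ (mul_le_mul_right hright _))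
  simp only [Finset.mul_sum]
  exact Finset.sum_le_sum fun j _ => Finset.sum_le_sum fun k hk =>
    pair_exclusion hψ hsym hsupp hC hC1 (Finset.ne_of_mem_erase hk).symm y R

end

/-- The closed square of side length `L` with lower left corner `(a, b)`. -/
def square (a b L : ℝ) : Set Plane := {y | y 0 ∈ Set.Icc a (a + L) ∧ y 1 ∈ Set.Icc b (b + L)}

lemma square_eq_preimage (a b L : ℝ) :
    square a b L = (WithLp.ofLp : Plane → Fin 2 → ℝ) ⁻¹' Set.Icc ![a, b] ![a + L, b + L] := by
  ext y
  simp [square, Pi.le_def, Fin.forall_fin_two]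
  tauto

lemma volume_square (a b : ℝ) {L : ℝ} (hL : 0 ≤ L) :
    volume (square a b L) = ENNReal.ofReal (L ^ 2) := by
  rw [square_eq_preimage, (PiLp.volume_preserving_ofLp (Fin 2)).measure_preimage
    measurableSet_Icc.nullMeasurableSet, Real.volume_Icc_pi]
  simp [Fin.prod_univ_two, sq, ENNReal.ofReal_mul hL]

lemma isCompact_square (a b L : ℝ) : IsCompact (square a b L) := by
  rw [square_eq_preimage]
  exact (EuclideanSpace.equiv (Fin 2) ℝ).toHomeomorph.isCompact_preimage.2 isCompact_Icc

lemma ball_subset_square {a b L R : ℝ} {v : Plane} (hv : v ∈ square a b L) :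
    Metric.ball v R ⊆ square (a - R) (b - R) (L + 2 * R) := by
  intro y hy
  rw [mem_ball_iff_norm] at hy
  have h : ∀ i, |y i - v i| < R := fun i =>
    (PiLp.norm_apply_le (y - v) i).trans_lt hy
  have h0 := abs_lt.1 (h 0)
  have h1 := abs_lt.1 (h 1)
  obtain ⟨⟨h2, h3⟩, h4, h5⟩ := hv
  refine ⟨⟨?_, ?_⟩, ?_, ?_⟩ <;> linarith

lemma measurable_diskInd_apply (R : ℝ) (j : Fin N) :
    Measurable fun p : Plane × (Fin N → Plane) => diskInd p.1 R (p.2 j) := by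
  have hs : MeasurableSet {p : Plane × (Fin N → Plane) | ‖p.2 j - p.1‖ < R} :=
    (isOpen_lt (by fun_prop) continuous_const).measurableSet
  convert (measurable_one : Measurable (1 : Plane × (Fin N → Plane) → ENNReal)).indicator hs
    using 1
  ext p
  by_cases h : ‖p.2 j - p.1‖ < R
  · rw [diskInd_of_lt h, Set.indicator_of_mem (by exact h), Pi.one_apply]
  · rw [diskInd_of_le (not_lt.1 h), Set.indicator_of_notMem (by exact h)]

lemma lintegral_lintegral_diskInd_mul (Q : Set Plane) (R : ℝ) (j : Fin N)
    {F : (Fin N → Plane) → ENNReal} (hF : Measurable F) :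
    ∫⁻ y in Q, ∫⁻ x, diskInd y R (x j) * F x
      = ∫⁻ x, volume (Metric.ball (x j) R ∩ Q) * F x := by
  have hm : Measurable fun p : Plane × (Fin N → Plane) => diskInd p.1 R (p.2 j) * F p.2 :=
    (measurable_diskInd_apply R j).mul (hF.comp measurable_snd)
  rw [lintegral_lintegral_swap hm.aemeasurable]
  refine lintegral_congr fun x => ?_
  have hsymm : ∀ y, diskInd y R (x j) = (Metric.ball (x j) R).indicator 1 y := fun y => by
    by_cases h : ‖x j - y‖ < R
    · rw [diskInd_of_lt h, Set.indicator_of_mem (by rwa [mem_ball_iff_norm']), Pi.one_apply]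
    · rw [diskInd_of_le (not_lt.1 h), Set.indicator_of_notMem (by rwa [mem_ball_iff_norm'])]
  simp only [hsymm]
  rw [lintegral_mul_const _ (measurable_one.indicator Metric.isOpen_ball.measurableSet),
    lintegral_indicator_one Metric.isOpen_ball.measurableSet,
    Measure.restrict_apply Metric.isOpen_ball.measurableSet]

section

variable {α C : ℝ} {ψ : (Fin N → Plane) → ℂ}

lemma integrable_kineticDensity (hψ : ContDiff ℝ (⊤ : ℕ∞) ψ)
    (hsupp : ∀ x ∈ tsupport ψ, ∀ j k : Fin N, j ≠ k → x j ≠ x k) {a b L : ℝ}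
    (hbox : ∀ x ∈ tsupport ψ, ∀ j : Fin N, x j ∈ square a b L) (j : Fin N) :
    Integrable (kineticDensity α ψ j) := by
  refine (continuous_kineticDensity hψ hsupp j).integrable_of_hasCompactSupport ?_
  refine HasCompactSupport.intro (isCompact_univ_pi fun _ : Fin N => isCompact_square a b L)
    fun x hx => ?_
  have hx' : x ∉ tsupport ψ := fun h => hx fun l _ => hbox x h l
  simp [kineticDensity, anyonD_eq_zero_of_notMem_tsupport α hx']

/-- The energy bound obtained by averaging the local exclusion inequality over all disks of
radius `R` meeting the box. -/
lemma averaged_exclusion (hψ : ContDiff ℝ (⊤ : ℕ∞) ψ)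
    (hsym : ∀ (σ : Equiv.Perm (Fin N)) (x : Fin N → Plane), ψ (x ∘ σ) = ψ x)
    (hnorm : ∫ x, ‖ψ x‖ ^ 2 = 1)
    (hsupp : ∀ x ∈ tsupport ψ, ∀ j k : Fin N, j ≠ k → x j ≠ x k) {a b L R : ℝ} (hL : 0 < L)
    (hR : 0 < R) (hbox : ∀ x ∈ tsupport ψ, ∀ j : Fin N, x j ∈ square a b L)
    (hC : ∀ p : ℕ, p ≤ N - 2 → ∀ q : ℤ, C ^ 2 ≤ ((2 * (p : ℝ) + 1) * α - 2 * q) ^ 2)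
    (hC1 : C ^ 2 ≤ 1) :
    C ^ 2 * (N * (Real.pi * R ^ 2))
      ≤ C ^ 2 * (L + 2 * R) ^ 2
        + 17.12 * R ^ 2 * (Real.pi * R ^ 2 * ∫ x, ∑ j, kineticDensity α ψ j x) := by
  set Q := square (a - R) (b - R) (L + 2 * R) with hQ
  have hvolQ : volume Q = ENNReal.ofReal ((L + 2 * R) ^ 2) := volume_square _ _ (by positivity)
  have hball : ∀ v : Plane, volume (Metric.ball v R) = ENNReal.ofReal (Real.pi * R ^ 2) :=
    fun v => by
      rw [EuclideanSpace.volume_ball_fin_two, mul_comm Real.pi, ENNReal.ofReal_mul (by positivity),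
        ENNReal.ofReal_pow hR.le]
  have hf : Measurable fun x => ENNReal.ofReal (‖ψ x‖ ^ 2) :=
    (hψ.continuous.norm.pow 2).measurable.ennreal_ofReal
  have hk : ∀ j : Fin N, Measurable fun x => ENNReal.ofReal (kineticDensity α ψ j x) := fun j =>
    (continuous_kineticDensity hψ hsupp j).measurable.ennreal_ofReal
  have hInt : Integrable fun x => ‖ψ x‖ ^ 2 := by
    by_contra h
    rw [integral_undef h] at hnorm
    exact zero_ne_one hnorm
  have hone : ∫⁻ x, ENNReal.ofReal (‖ψ x‖ ^ 2) = 1 := by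
    rw [← ofReal_integral_eq_lintegral_ofReal hInt (ae_of_all _ fun _ => by positivity), hnorm,
      ENNReal.ofReal_one]
  have hmass : ∀ j : Fin N, ∫⁻ y in Q, ∫⁻ x, diskInd y R (x j) * ENNReal.ofReal (‖ψ x‖ ^ 2)
      = ENNReal.ofReal (Real.pi * R ^ 2) := fun j => by
    rw [lintegral_lintegral_diskInd_mul Q R j hf]
    calc ∫⁻ x, volume (Metric.ball (x j) R ∩ Q) * ENNReal.ofReal (‖ψ x‖ ^ 2)
        = ∫⁻ x, ENNReal.ofReal (Real.pi * R ^ 2) * ENNReal.ofReal (‖ψ x‖ ^ 2) := by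
          refine lintegral_congr fun x => ?_
          by_cases hx : x ∈ tsupport ψ
          · rw [Set.inter_eq_left.2 (ball_subset_square (hbox x hx j)), hball]
          · simp [image_eq_zero_of_notMem_tsupport hx]
      _ = _ := by rw [lintegral_const_mul _ hf, hone, mul_one]
  have hkin : ∀ j : Fin N,
      ∫⁻ y in Q, ∫⁻ x, diskInd y R (x j) * ENNReal.ofReal (kineticDensity α ψ j x)
        ≤ ENNReal.ofReal (Real.pi * R ^ 2 * ∫ x, kineticDensity α ψ j x) := fun j => by
    rw [lintegral_lintegral_diskInd_mul Q R j (hk j), ENNReal.ofReal_mul (by positivity),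
      ofReal_integral_eq_lintegral_ofReal (integrable_kineticDensity hψ hsupp hbox j)
        (ae_of_all _ fun x => kineticDensity_nonneg j x), ← lintegral_const_mul _ (hk j)]
    refine lintegral_mono fun x => mul_le_mul_left ?_ _
    exact (measure_mono Set.inter_subset_left).trans_eq (hball (x j))
  have hmeas : ∀ (F : Fin N → (Fin N → Plane) → ENNReal), (∀ j, Measurable (F j)) → ∀ j,
      Measurable fun y => ∫⁻ x, diskInd y R (x j) * F j x := fun F hF j =>
    Measurable.lintegral_prod_right'
      (f := fun p : Plane × (Fin N → Plane) => diskInd p.1 R (p.2 j) * F j p.2)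
      ((measurable_diskInd_apply R j).mul ((hF j).comp measurable_snd))
  have key := lintegral_mono (μ := volume.restrict Q)
    fun y => disk_exclusion hψ hsym hsupp hC hC1 y R
  rw [lintegral_const_mul' _ _ ENNReal.ofReal_ne_top,
    lintegral_finsetSum _ (fun j _ => hmeas _ (fun _ => hf) j),
    lintegral_add_left measurable_const, lintegral_const_mul' _ _ ENNReal.ofReal_ne_top,
    lintegral_const_mul' _ _ ENNReal.ofReal_ne_top,
    lintegral_finsetSum _ (fun j _ => hmeas _ hk j), hone, setLIntegral_const, one_mul,
    hvolQ] at key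
  simp only [hmass, Finset.sum_const, Finset.card_univ, Fintype.card_fin, nsmul_eq_mul] at key
  have hkin0 : ∀ j : Fin N, 0 ≤ ∫ x, kineticDensity α ψ j x := fun j =>
    integral_nonneg fun x => kineticDensity_nonneg j x
  have hpos : 0 ≤ ∑ j : Fin N, Real.pi * R ^ 2 * ∫ x, kineticDensity α ψ j x :=
    Finset.sum_nonneg fun j _ => mul_nonneg (by positivity) (hkin0 j)
  have key' := key.trans (add_le_add le_rfl (mul_le_mul_right
    (Finset.sum_le_sum fun j _ => hkin j) _))
  rw [← ENNReal.ofReal_sum_of_nonneg fun j _ => mul_nonneg (by positivity) (hkin0 j),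
    ← ENNReal.ofReal_natCast, ← ENNReal.ofReal_mul (by positivity),
    ← ENNReal.ofReal_mul (by positivity), ← ENNReal.ofReal_mul (by positivity),
    ← ENNReal.ofReal_mul (by positivity), ← ENNReal.ofReal_add (by positivity)
      (mul_nonneg (by positivity) hpos), ENNReal.ofReal_le_ofReal_iff
      (add_nonneg (by positivity) (mul_nonneg (by positivity) hpos)), ← Finset.mul_sum,
    ← integral_finsetSum _ fun j _ => integrable_kineticDensity hψ hsupp hbox j] at key'
  exact key'

end

lemma Calpha_nonneg (α : ℝ) (n : ℕ) : 0 ≤ Calpha α n :=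
  Real.sInf_nonneg fun _ ⟨_, _, _, h⟩ => h ▸ abs_nonneg _

lemma Calpha_le (α : ℝ) {n p : ℕ} (hp : p ≤ n - 2) (q : ℤ) :
    Calpha α n ≤ |(2 * (p : ℝ) + 1) * α - 2 * (q : ℝ)| :=
  csInf_le ⟨0, fun _ ⟨_, _, _, h⟩ => h ▸ abs_nonneg _⟩ ⟨p, q, hp, rfl⟩

lemma Calpha_sq_le (α : ℝ) {n p : ℕ} (hp : p ≤ n - 2) (q : ℤ) :
    Calpha α n ^ 2 ≤ ((2 * (p : ℝ) + 1) * α - 2 * (q : ℝ)) ^ 2 := by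
  rw [← sq_abs (_ - _)]
  exact pow_le_pow_left₀ (Calpha_nonneg α n) (Calpha_le α hp q) 2

lemma Calpha_sq_le_one (α : ℝ) (n : ℕ) : Calpha α n ^ 2 ≤ 1 := by
  have h := Calpha_le α (n := n) (Nat.zero_le _) (round (α / 2))
  have h2 := abs_sub_round (α / 2)
  have h3 : |(2 * ((0 : ℕ) : ℝ) + 1) * α - 2 * (round (α / 2) : ℝ)|
      = 2 * |α / 2 - round (α / 2)| := by
    rw [← abs_two, ← abs_mul, abs_two]
    congr 1
    push_cast
    ring
  have h4 := Calpha_nonneg α n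
  rw [h3] at h
  nlinarith

lemma density_bound_of_radius_bound {s γ L C T : ℝ} (hs : 0 < s) (hγ : 0 < γ) (hL : 0 < L)
    (hT : 0 ≤ T)
    (h : C ^ 2 * (s ^ 2 * (Real.pi * (γ * L / s) ^ 2))
      ≤ C ^ 2 * (L + 2 * (γ * L / s)) ^ 2
        + 17.12 * (γ * L / s) ^ 2 * (Real.pi * (γ * L / s) ^ 2 * T)) :
    0.169 * (1 / (Real.pi * γ ^ 2) - (1 + 2 * γ / s) ^ 2 / (Real.pi ^ 2 * γ ^ 4))
      * (C ^ 2 * (s ^ 2) ^ 2) ≤ T * L ^ 2 := by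
  have hπ := Real.pi_gt_d2
  have hπ0 := Real.pi_pos
  have h1 : C ^ 2 * (Real.pi * γ ^ 2 - (1 + 2 * γ / s) ^ 2) * (s ^ 2) ^ 2
      ≤ 17.12 * Real.pi * γ ^ 4 * (T * L ^ 2) := by
    have e1 : C ^ 2 * (s ^ 2 * (Real.pi * (γ * L / s) ^ 2)) - C ^ 2 * (L + 2 * (γ * L / s)) ^ 2
        = L ^ 2 * (C ^ 2 * (Real.pi * γ ^ 2 - (1 + 2 * γ / s) ^ 2)) := by
      field_simp
    have e2 : 17.12 * (γ * L / s) ^ 2 * (Real.pi * (γ * L / s) ^ 2 * T)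
        = L ^ 2 * (17.12 * Real.pi * γ ^ 4 * (T * L ^ 2) / (s ^ 2) ^ 2) := by
      field_simp
    rw [← le_div_iff₀ (by positivity)]
    refine le_of_mul_le_mul_left ?_ (pow_pos hL 2)
    linarith
  have e3 : 0.169 * (1 / (Real.pi * γ ^ 2) - (1 + 2 * γ / s) ^ 2 / (Real.pi ^ 2 * γ ^ 4))
      * (C ^ 2 * (s ^ 2) ^ 2)
      = 0.169 * (C ^ 2 * (Real.pi * γ ^ 2 - (1 + 2 * γ / s) ^ 2) * (s ^ 2) ^ 2)
        / (Real.pi ^ 2 * γ ^ 4) := by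
    field_simp
  rw [e3, div_le_iff₀ (by positivity)]
  have h2 : 0 ≤ (Real.pi - 0.169 * 17.12) * (Real.pi * γ ^ 4 * (T * L ^ 2)) :=
    mul_nonneg (by norm_num at hπ ⊢; linarith) (by positivity)
  linarith

end

/-- **Ground-state energy of `N` anyons in a box.** For a normalized symmetric `N`-anyon
wave function supported in `Q_L^N` (a square of side `L`) and away from the diagonals,
`(1/2)∫ ∑_j ‖D_jψ‖² ≥ (0.169/2)·c_N·C_{α,N}²·N²/L²`, where
`c_N = sup_{γ>0} (1/(πγ²) - (1+2γ/√N)²/(π²γ⁴))`. -/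
theorem anyon_gas_energy_box
    (α : ℝ) (N : ℕ) (hN : 2 ≤ N) (L c₁ c₂ : ℝ) (hL : 0 < L)
    (QL : Set (EuclideanSpace ℝ (Fin 2)))
    (hQL : QL = {y : EuclideanSpace ℝ (Fin 2) |
      y 0 ∈ Set.Icc c₁ (c₁ + L) ∧ y 1 ∈ Set.Icc c₂ (c₂ + L)})
    (ψ : (Fin N → EuclideanSpace ℝ (Fin 2)) → ℂ) (hψ : ContDiff ℝ (⊤ : ℕ∞) ψ)
    (hsym : ∀ (σ : Equiv.Perm (Fin N)) (x : Fin N → EuclideanSpace ℝ (Fin 2)),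
      ψ (x ∘ σ) = ψ x)
    (hnorm : ∫ x : Fin N → EuclideanSpace ℝ (Fin 2), ‖ψ x‖ ^ 2 = 1)
    (hbox : ∀ x ∈ tsupport ψ, ∀ j : Fin N, x j ∈ QL)
    (hsupp : ∀ x ∈ tsupport ψ, ∀ j k : Fin N, j ≠ k → x j ≠ x k) :
    (1 / 2) * (∫ x : Fin N → EuclideanSpace ℝ (Fin 2),
        ∑ j : Fin N, ∑ i : Fin 2, ‖anyonD α ψ x j i‖ ^ 2)
      ≥ (0.169 / 2) *
        sSup {t : ℝ | ∃ γ : ℝ, 0 < γ ∧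
          t = 1 / (Real.pi * γ ^ 2)
            - (1 + 2 * γ / Real.sqrt (N : ℝ)) ^ 2 / (Real.pi ^ 2 * γ ^ 4)} *
        Calpha α N ^ 2 * (N : ℝ) ^ 2 / L ^ 2 := by
  subst hQL
  set C := Calpha α N with hCdef
  set T := ∫ x : Fin N → EuclideanSpace ℝ (Fin 2),
        ∑ j : Fin N, ∑ i : Fin 2, ‖anyonD α ψ x j i‖ ^ 2
  have hT0 : 0 ≤ T := integral_nonneg fun x => by positivity
  have hN0 : (0 : ℝ) < N := by exact_mod_cast (by omega : 0 < N)
  rcases (Calpha_nonneg α N).eq_or_lt with hC0 | hC0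
  · rw [hCdef, ← hC0]
    simpa using hT0
  have hbound : ∀ γ : ℝ, 0 < γ → 0.169 * (1 / (Real.pi * γ ^ 2)
      - (1 + 2 * γ / Real.sqrt (N : ℝ)) ^ 2 / (Real.pi ^ 2 * γ ^ 4)) * (C ^ 2 * N ^ 2)
      ≤ T * L ^ 2 := by
    intro γ hγ
    have hs : 0 < Real.sqrt (N : ℝ) := Real.sqrt_pos.2 hN0
    have hs2 : Real.sqrt (N : ℝ) ^ 2 = N := Real.sq_sqrt hN0.le
    have h := averaged_exclusion hψ hsym hnorm hsupp hL (R := γ * L / Real.sqrt (N : ℝ))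
      (by positivity) hbox (fun p hp q => Calpha_sq_le α hp q) (Calpha_sq_le_one α N)
    have hb := density_bound_of_radius_bound (C := C) (T := T) hs hγ hL hT0 (by rw [hs2]; exact h)
    rwa [hs2] at hb
  have hsup : sSup {t : ℝ | ∃ γ : ℝ, 0 < γ ∧
          t = 1 / (Real.pi * γ ^ 2)
            - (1 + 2 * γ / Real.sqrt (N : ℝ)) ^ 2 / (Real.pi ^ 2 * γ ^ 4)}
      ≤ T * L ^ 2 / (0.169 * (C ^ 2 * N ^ 2)) := by
    refine csSup_le ⟨_, 1, one_pos, rfl⟩ ?_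
    rintro t ⟨γ, hγ, rfl⟩
    rw [le_div_iff₀ (by positivity)]
    linarith [hbound γ hγ]
  rw [le_div_iff₀ (by positivity)] at hsup
  rw [ge_iff_le, div_le_iff₀ (by positivity)]
  linarith
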